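/- arXiv:2402.10656 — 6 statements merged into one kernel-verified Lean document; each statement's English description precedes it below -/
import Mathlib

section
/- Let k ≥ 3 be an integer and S > 0. There exist r ∈ (0,1) and C > 0, depending only on k and S, such that for every ε ∈ (0,1), every bounded open interval I = (a,b), and every function u that is k times continuously differentiable on a neighbourhood of [a,b] with F_ε(u; I) ≤ S, if (i) |u'(t)| < 1/√ε for all t ∈ (a,b) and |u'(a)| = 1/√ε or |u'(b)| = 1/√ε, and (ii) ∫_I (u'(t))² dt < (r/ε)|I|, then |I| ≥ C ε^{k/(k−1)}. -/
open MeasureTheory Set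

/-- The localized energy `F_ε(u; (a,b)) = ∫_{(a,b)} min{(u')², 1/ε} + ε^{2k-1} ∫_{(a,b)} (u^{(k)})²`. -/
noncomputable def Fe (k : ℕ) (ε : ℝ) (u : ℝ → ℝ) (a b : ℝ) : ℝ :=
  (∫ t in Ioo a b, min ((deriv u t) ^ 2) (1 / ε)) +
    ε ^ (2 * k - 1) * ∫ t in Ioo a b, (iteratedDeriv k u t) ^ 2

lemma poly_bound (m : ℕ) : ∃ A : ℝ, 1 ≤ A ∧ ∀ c : Fin m → ℝ, ∀ s ∈ Icc (0:ℝ) 1,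
    (∑ i, c i * s ^ (i:ℕ)) ^ 2 ≤ A * ∫ x in (0:ℝ)..1, (∑ i, c i * x ^ (i:ℕ)) ^ 2 := by
  set g : (Fin m → ℝ) → ℝ := fun c => ∫ x in (0:ℝ)..1, (∑ i, c i * x ^ (i:ℕ)) ^ 2 with hg
  have hcont : Continuous g := by
    apply intervalIntegral.continuous_parametric_intervalIntegral_of_continuous'
    simp only [Function.uncurry_def]
    fun_prop
  have hnn : ∀ c, 0 ≤ g c := fun c =>
    intervalIntegral.integral_nonneg zero_le_one (fun x _ => sq_nonneg _)
  have hpos : ∀ c, c ≠ 0 → 0 < g c := by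
    intro c hc
    apply intervalIntegral.integral_pos one_pos (by fun_prop) (fun x _ => sq_nonneg _)
    by_contra! hcon
    apply hc
    set P : Polynomial ℝ := ∑ i : Fin m, Polynomial.monomial (i:ℕ) (c i) with hP
    have hP0 : P = 0 := by
      apply Polynomial.eq_zero_of_infinite_isRoot
      apply (Set.Icc_infinite (zero_lt_one (α := ℝ))).mono
      intro x hx
      have h1 := hcon x hx
      have h2 : (∑ i, c i * x ^ (i:ℕ)) = 0 := by
        have := sq_nonneg (∑ i, c i * x ^ (i:ℕ))
        exact pow_eq_zero_iff (two_ne_zero) |>.1 (le_antisymm h1 this)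
      simp only [mem_ofPred_eq, Polynomial.IsRoot, hP, Polynomial.eval_finsetSum,
        Polynomial.eval_monomial]
      exact h2
    funext j
    have h3 : P.coeff (j:ℕ) = 0 := by rw [hP0]; simp
    rw [hP] at h3
    simp only [Polynomial.finsetSum_coeff, Polynomial.coeff_monomial] at h3
    rw [Finset.sum_eq_single j] at h3
    · simpa using h3
    · intro b _ hb
      rw [if_neg]
      exact fun h => hb (Fin.ext h)
    · simp
  have hδ : ∃ δ > 0, ∀ c, δ * ‖c‖ ^ 2 ≤ g c := by
    rcases (Metric.sphere (0 : Fin m → ℝ) 1).eq_empty_or_nonempty with he | hne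
    · refine ⟨1, one_pos, fun c => ?_⟩
      by_cases hc : c = 0
      · simp [hc, hnn]
      · exfalso
        have : ‖c‖⁻¹ • c ∈ Metric.sphere (0 : Fin m → ℝ) 1 := by
          simp [norm_smul, hc]
        rw [he] at this
        exact this
    · obtain ⟨c0, hc0, hmin⟩ := (isCompact_sphere (0 : Fin m → ℝ) 1).exists_isMinOn hne
        hcont.continuousOn
      refine ⟨g c0, hpos c0 (by rintro rfl; simp at hc0), fun c => ?_⟩
      by_cases hc : c = 0
      · simp [hc, hnn]
      · have hm : ‖c‖⁻¹ • c ∈ Metric.sphere (0 : Fin m → ℝ) 1 := by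
          simp [norm_smul, hc]
        have h1 : g c0 ≤ g (‖c‖⁻¹ • c) := hmin hm
        have h2 : g (‖c‖⁻¹ • c) = (‖c‖⁻¹) ^ 2 * g c := by
          simp only [hg]
          rw [← intervalIntegral.integral_const_mul]
          congr 1
          ext x
          rw [← mul_pow, Finset.mul_sum]
          simp [mul_assoc]
        have hn : 0 < ‖c‖ := norm_pos_iff.2 hc
        rw [h2] at h1
        calc g c0 * ‖c‖ ^ 2 ≤ (‖c‖⁻¹) ^ 2 * g c * ‖c‖ ^ 2 := by gcongr
          _ = g c := by field_simp
  obtain ⟨δ, hδ0, hδ⟩ := hδ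
  refine ⟨(m:ℝ) ^ 2 / δ + 1, by linarith [show 0 ≤ (m:ℝ) ^ 2 / δ by positivity], ?_⟩
  intro c s hs
  change _ ≤ _ * g c
  have h1 : |∑ i, c i * s ^ (i:ℕ)| ≤ m * ‖c‖ := by
    calc |∑ i, c i * s ^ (i:ℕ)| ≤ ∑ i, |c i * s ^ (i:ℕ)| := Finset.abs_sum_le_sum_abs _ _
      _ ≤ ∑ i : Fin m, ‖c‖ := by
        apply Finset.sum_le_sum
        intro i _
        rw [abs_mul, abs_of_nonneg (pow_nonneg hs.1 _)]
        have h2 : s ^ (i:ℕ) ≤ 1 := pow_le_one₀ hs.1 hs.2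
        have h3 : |c i| ≤ ‖c‖ := norm_le_pi_norm c i
        calc |c i| * s ^ (i:ℕ) ≤ |c i| * 1 := by gcongr
          _ ≤ ‖c‖ := by simpa using h3
      _ = m * ‖c‖ := by simp
  have h2 : (∑ i, c i * s ^ (i:ℕ)) ^ 2 ≤ (m * ‖c‖) ^ 2 :=
    sq_le_sq' (by linarith [abs_le.1 h1]) (abs_le.1 h1).2
  have h3 : ‖c‖ ^ 2 ≤ g c / δ := by rw [le_div_iff₀ hδ0]; linarith [hδ c]
  calc _ ≤ (m:ℝ) ^ 2 * ‖c‖ ^ 2 := by rw [← mul_pow]; exact h2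
    _ ≤ (m:ℝ) ^ 2 * (g c / δ) := by gcongr
    _ ≤ ((m:ℝ) ^ 2 / δ + 1) * g c := by
      have := hnn c
      rw [add_mul, one_mul]
      have : (m:ℝ) ^ 2 * (g c / δ) = (m:ℝ) ^ 2 / δ * g c := by ring
      linarith

lemma cs_bound {a b : ℝ} (hab : a < b) {f : ℝ → ℝ} (hf : ContinuousOn f (Icc a b)) :
    (∫ t in a..b, |f t|) ^ 2 ≤ (b - a) * ∫ t in a..b, f t ^ 2 := by
  set M := ∫ t in a..b, |f t| with hM
  have hL : 0 < b - a := sub_pos.2 hab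
  rw [← uIcc_of_le hab.le] at hf
  have i1 : IntervalIntegrable (fun t => |f t|) volume a b := hf.abs.intervalIntegrable
  have i2 : IntervalIntegrable (fun t => f t ^ 2) volume a b := (hf.pow 2).intervalIntegrable
  have h : 0 ≤ ∫ t in a..b, (f t ^ 2 - 2 * (M / (b - a)) * |f t| + (M / (b - a)) ^ 2) := by
    apply intervalIntegral.integral_nonneg hab.le
    intro t _
    have := sq_nonneg (|f t| - M / (b - a))
    rw [← sq_abs (f t)]
    nlinarith
  rw [intervalIntegral.integral_add (i2.sub (i1.const_mul _)) (by simp),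
    intervalIntegral.integral_sub i2 (i1.const_mul _), intervalIntegral.integral_const_mul,
    intervalIntegral.integral_const, ← hM, smul_eq_mul] at h
  have e : (∫ t in a..b, f t ^ 2) - 2 * (M / (b - a)) * M + (b - a) * (M / (b - a)) ^ 2
    = (∫ t in a..b, f t ^ 2) - M ^ 2 / (b - a) := by field_simp; ring
  rw [e] at h
  have : M ^ 2 / (b - a) ≤ ∫ t in a..b, f t ^ 2 := by linarith
  rw [div_le_iff₀ hL] at this
  linarith

lemma taylor_bound {a b : ℝ} (hab : a < b) (n : ℕ) {v : ℝ → ℝ}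
    (hv : ∀ x ∈ Icc a b, ContDiffAt ℝ (n + 1 : ℕ) v x)
    (hc : ContinuousOn (iteratedDeriv (n + 1) v) (Icc a b)) :
    ∃ c : Fin (n + 1) → ℝ, ∀ x ∈ Icc a b,
      |v x - ∑ i, c i * ((x - a) / (b - a)) ^ (i:ℕ)| ≤
        (b - a) ^ n * ∫ t in a..b, |iteratedDeriv (n + 1) v t| := by
  have hL : 0 < b - a := sub_pos.2 hab
  have hint : IntervalIntegrable (fun t => |iteratedDeriv (n + 1) v t|) volume a b := by
    rw [← uIcc_of_le hab.le] at hc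
    exact hc.abs.intervalIntegrable
  refine ⟨fun i => ((i:ℕ).factorial : ℝ)⁻¹ * (b - a) ^ (i:ℕ) * iteratedDeriv i v a, ?_⟩
  intro x hx
  have hsum : ∑ i : Fin (n + 1), ((i:ℕ).factorial : ℝ)⁻¹ * (b - a) ^ (i:ℕ) * iteratedDeriv i v a
      * ((x - a) / (b - a)) ^ (i:ℕ) = ∑ i ∈ Finset.range (n + 1),
        (((i:ℕ).factorial : ℝ)⁻¹ * (x - a) ^ i) * iteratedDeriv i v a := by
    rw [← Fin.sum_univ_eq_sum_range (fun i =>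
      (((i:ℕ).factorial : ℝ)⁻¹ * (x - a) ^ i) * iteratedDeriv i v a)]
    apply Finset.sum_congr rfl
    intro i _
    rw [div_pow]
    field_simp
  rw [hsum]
  have hnn : 0 ≤ (b - a) ^ n * ∫ t in a..b, |iteratedDeriv (n + 1) v t| :=
    mul_nonneg (by positivity) (intervalIntegral.integral_nonneg hab.le fun _ _ => abs_nonneg _)
  rcases eq_or_lt_of_le hx.1 with rfl | hax
  · rw [Finset.sum_range_succ']
    simpa using hnn
  have hsub : uIcc a x ⊆ Icc a b := by
    rw [uIcc_of_le hx.1]; exact Icc_subset_Icc le_rfl hx.2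
  have hud : UniqueDiffOn ℝ (uIcc a x) := uniqueDiffOn_uIcc hax.ne
  have hT := taylor_integral_remainder (f := v) (x := x) (x₀ := a) (n := n)
    (fun y hy => (hv y (hsub hy)).contDiffWithinAt)
  rw [taylor_within_apply] at hT
  have e1 : ∑ i ∈ Finset.range (n + 1),
        (((i:ℕ).factorial : ℝ)⁻¹ * (x - a) ^ i) * iteratedDeriv i v a =
      ∑ i ∈ Finset.range (n + 1),
        (((i:ℕ).factorial : ℝ)⁻¹ * (x - a) ^ i) • iteratedDerivWithin i v (uIcc a x) a := by
    apply Finset.sum_congr rfl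
    intro i hi
    rw [smul_eq_mul, iteratedDerivWithin_eq_iteratedDeriv hud _ left_mem_uIcc]
    apply (hv a ⟨le_rfl, hab.le⟩).of_le
    have := Finset.mem_range.1 hi
    exact_mod_cast this.le
  rw [e1, hT]
  have e2 : ∫ t in a..x, ((x - t) ^ n / (n.factorial : ℝ)) •
      iteratedDerivWithin (n + 1) v (uIcc a x) t = ∫ t in a..x, ((x - t) ^ n / (n.factorial : ℝ)) *
      iteratedDeriv (n + 1) v t := by
    apply intervalIntegral.integral_congr
    intro t ht
    simp only [smul_eq_mul]
    rw [iteratedDerivWithin_eq_iteratedDeriv hud (hv t (hsub ht)) ht]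
  rw [e2]
  have hint' : IntervalIntegrable (fun t => |iteratedDeriv (n + 1) v t|) volume a x :=
    hint.mono_set (by rw [uIcc_of_le hab.le]; exact hsub)
  calc |∫ t in a..x, ((x - t) ^ n / (n.factorial : ℝ)) * iteratedDeriv (n + 1) v t|
      ≤ ∫ t in a..x, (b - a) ^ n * |iteratedDeriv (n + 1) v t| := by
        rw [← Real.norm_eq_abs]
        apply intervalIntegral.norm_integral_le_of_norm_le hx.1 _ (hint'.const_mul _)
        apply Filter.Eventually.of_forall
        intro t ht
        rw [norm_mul, Real.norm_eq_abs, Real.norm_eq_abs]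
        gcongr
        have h0 : 0 ≤ x - t := by linarith [ht.2]
        rw [abs_of_nonneg (by positivity)]
        calc (x - t) ^ n / (n.factorial : ℝ) ≤ (x - t) ^ n :=
              div_le_self (by positivity) (by exact_mod_cast n.factorial_pos)
          _ ≤ (b - a) ^ n := by
              gcongr
              · exact hx.2
              · exact ht.1.le
    _ = (b - a) ^ n * ∫ t in a..x, |iteratedDeriv (n + 1) v t| :=
        intervalIntegral.integral_const_mul _ _
    _ ≤ _ := by
        gcongr
        apply intervalIntegral.integral_mono_interval le_rfl hx.1 hx.2 _ hint
        exact Filter.Eventually.of_forall fun _ => abs_nonneg _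

/-- interpolation inequality -/
lemma interp (n : ℕ) : ∃ A : ℝ, 1 ≤ A ∧ ∀ a b : ℝ, a < b → ∀ v : ℝ → ℝ,
    (∀ x ∈ Icc a b, ContDiffAt ℝ (n + 1 : ℕ) v x) →
    ContinuousOn (iteratedDeriv (n + 1) v) (Icc a b) →
    ∀ x ∈ Icc a b, v x ^ 2 ≤ A * ((∫ t in a..b, v t ^ 2) / (b - a)) +
      A * ((b - a) ^ (2 * n + 1) * ∫ t in a..b, iteratedDeriv (n + 1) v t ^ 2) := by
  obtain ⟨A, hA1, hA⟩ := poly_bound (n + 1)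
  refine ⟨4 * A + 2, by linarith, ?_⟩
  intro a b hab v hv hc x hx
  have hL : 0 < b - a := sub_pos.2 hab
  obtain ⟨c, hcT⟩ := taylor_bound hab n hv hc
  set M := ∫ t in a..b, |iteratedDeriv (n + 1) v t| with hM
  have hcs : M ^ 2 ≤ (b - a) * ∫ t in a..b, iteratedDeriv (n + 1) v t ^ 2 := cs_bound hab hc
  set K := (b - a) ^ n * M with hK
  set J := (b - a) ^ (2 * n + 1) * ∫ t in a..b, iteratedDeriv (n + 1) v t ^ 2 with hJ
  have hKJ : K ^ 2 ≤ J := by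
    calc K ^ 2 = (b - a) ^ (2 * n) * M ^ 2 := by rw [hK]; ring
      _ ≤ (b - a) ^ (2 * n) * ((b - a) * ∫ t in a..b, iteratedDeriv (n + 1) v t ^ 2) := by gcongr
      _ = J := by rw [hJ]; ring
  set P : ℝ → ℝ := fun s => ∑ i, c i * s ^ (i:ℕ) with hP
  have hPc : Continuous P := by rw [hP]; fun_prop
  have hR : ∀ y ∈ Icc a b, (v y - P ((y - a) / (b - a))) ^ 2 ≤ K ^ 2 := by
    intro y hy
    have := abs_le.1 (hcT y hy)
    exact sq_le_sq' this.1 this.2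
  have hvc : ContinuousOn v (uIcc a b) := by
    rw [uIcc_of_le hab.le]
    exact fun y hy => (hv y hy).continuousAt.continuousWithinAt
  have iv : IntervalIntegrable (fun t => v t ^ 2) volume a b := (hvc.pow 2).intervalIntegrable
  have hsc : ∫ t in a..b, P ((t - a) / (b - a)) ^ 2 = (b - a) * ∫ s in (0:ℝ)..1, P s ^ 2 := by
    have := intervalIntegral.integral_comp_div_sub (a := a) (b := b) (fun s => P s ^ 2) hL.ne' (a / (b - a))
    simp only [← sub_div] at this
    rw [this]
    simp [hL.ne']
  have hPI : (b - a) * ∫ s in (0:ℝ)..1, P s ^ 2 ≤ 2 * (∫ t in a..b, v t ^ 2) + (b - a) * (2 * J) := by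
    rw [← hsc, ← intervalIntegral.integral_const_mul]
    have : (b - a) * (2 * J) = ∫ t in a..b, 2 * J := by simp; ring
    rw [this, ← intervalIntegral.integral_add (iv.const_mul 2) (by simp)]
    apply intervalIntegral.integral_mono_on hab.le
    · apply Continuous.intervalIntegrable; fun_prop
    · exact (iv.const_mul 2).add (by simp)
    · intro y hy
      have := hR y hy
      nlinarith [sq_nonneg (2 * v y - P ((y - a) / (b - a)))]
  set V := ∫ t in a..b, v t ^ 2 with hV
  have hI : ∫ s in (0:ℝ)..1, P s ^ 2 ≤ 2 * (V / (b - a)) + 2 * J := by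
    have : 2 * (V / (b - a)) + 2 * J = (2 * V + (b - a) * (2 * J)) / (b - a) := by field_simp
    rw [this, le_div_iff₀ hL]
    linarith
  have hPx : P ((x - a) / (b - a)) ^ 2 ≤ A * ∫ s in (0:ℝ)..1, P s ^ 2 := by
    apply hA c
    exact ⟨div_nonneg (by linarith [hx.1]) hL.le, by rw [div_le_one hL]; linarith [hx.2]⟩
  have hV0 : 0 ≤ V / (b - a) :=
    div_nonneg (intervalIntegral.integral_nonneg hab.le fun _ _ => sq_nonneg _) hL.le
  have h1 := hR x hx
  have h2 : v x ^ 2 ≤ 2 * P ((x - a) / (b - a)) ^ 2 + 2 * J := by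
    nlinarith [sq_nonneg (v x - 2 * P ((x - a) / (b - a)))]
  have h3 : A * ∫ s in (0:ℝ)..1, P s ^ 2 ≤ A * (2 * (V / (b - a)) + 2 * J) := by gcongr
  nlinarith

lemma final_ineq (k : ℕ) (hk : 3 ≤ k) (c ε L : ℝ) (hc : 0 < c) (hc1 : c ≤ 1) (hε : 0 < ε)
    (hε1 : ε < 1) (hL : 0 < L) (h : c * ε ^ (2 * k - 2) ≤ L ^ (2 * k - 3)) :
    c * ε ^ ((k:ℝ) / ((k:ℝ) - 1)) ≤ L := by
  have hk' : (3:ℝ) ≤ k := by exact_mod_cast hk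
  apply le_of_pow_le_pow_left₀ (n := 2 * k - 3) (by omega) hL.le
  refine le_trans ?_ h
  rw [mul_pow]
  have h1 : c ^ (2 * k - 3) ≤ c := pow_le_of_le_one hc.le hc1 (by omega)
  have h2 : (ε ^ ((k:ℝ) / ((k:ℝ) - 1))) ^ (2 * k - 3) ≤ ε ^ (2 * k - 2) := by
    rw [← Real.rpow_natCast, ← Real.rpow_mul hε.le, ← Real.rpow_natCast ε (2 * k - 2)]
    apply Real.rpow_le_rpow_of_exponent_ge hε hε1.le
    rw [Nat.cast_sub (by omega), Nat.cast_sub (by omega)]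
    push_cast
    rw [div_mul_eq_mul_div, le_div_iff₀ (by linarith)]
    nlinarith
  gcongr

theorem length_lower_bound_small_L2 (k : ℕ) (hk : 3 ≤ k) (S : ℝ) (hS : 0 < S) :
    ∃ r ∈ Ioo (0:ℝ) 1, ∃ C : ℝ, 0 < C ∧
      ∀ ε ∈ Ioo (0:ℝ) 1, ∀ a b : ℝ, a < b →
      ∀ u : ℝ → ℝ, (∃ U : Set ℝ, IsOpen U ∧ Icc a b ⊆ U ∧ ContDiffOn ℝ k u U) →
      Fe k ε u a b ≤ S →
      (∀ t ∈ Ioo a b, |deriv u t| < 1 / Real.sqrt ε) →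
      (|deriv u a| = 1 / Real.sqrt ε ∨ |deriv u b| = 1 / Real.sqrt ε) →
      (∫ t in Ioo a b, (deriv u t) ^ 2) < r / ε * (b - a) →
      C * ε ^ ((k:ℝ) / ((k:ℝ) - 1)) ≤ b - a := by
  obtain ⟨A, hA1, hA⟩ := interp (k - 2)
  have hA0 : 0 < A := by linarith
  refine ⟨1 / (2 * A), ⟨by positivity, by rw [div_lt_one (by positivity)]; linarith⟩,
    min 1 (1 / (2 * A * S)), by positivity, ?_⟩
  rintro ε ⟨hε, hε1⟩ a b hab u ⟨U, hUo, hU, hu⟩ hF - hend hV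
  have hL : 0 < b - a := sub_pos.2 hab
  have hk1 : k - 2 + 1 + 1 = k := by omega
  have hit : iteratedDeriv (k - 2 + 1) (deriv u) = iteratedDeriv k u := by
    rw [← iteratedDeriv_succ', hk1]
  have hud : UniqueDiffOn ℝ U := hUo.uniqueDiffOn
  have hcont : ContinuousOn (iteratedDeriv (k - 2 + 1) (deriv u)) (Icc a b) := by
    rw [hit]
    have h1 := hu.continuousOn_iteratedDerivWithin (m := k) le_rfl hud
    exact (h1.congr (iteratedDerivWithin_of_isOpen hUo).symm).mono hU
  have hd : ∀ x ∈ Icc a b, ContDiffAt ℝ (k - 2 + 1 : ℕ) (deriv u) x := by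
    intro x hx
    have h1 : ContDiffOn ℝ (k - 2 + 1 : ℕ) (deriv u) U := by
      apply hu.deriv_of_isOpen hUo
      exact_mod_cast hk1.le
    exact h1.contDiffAt (hUo.mem_nhds (hU hx))
  have key := hA a b hab (deriv u) hd hcont
  rw [hit] at key
  have hIoo : ∀ f : ℝ → ℝ, ∫ t in a..b, f t = ∫ t in Ioo a b, f t := by
    intro f
    rw [intervalIntegral.integral_of_le hab.le, integral_Ioc_eq_integral_Ioo]
  rw [hIoo, hIoo] at key
  set V := ∫ t in Ioo a b, (deriv u t) ^ 2
  set J := ∫ t in Ioo a b, (iteratedDeriv k u t) ^ 2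
  have hJ : ε ^ (2 * k - 1) * J ≤ S := by
    have h0 : 0 ≤ ∫ t in Ioo a b, min ((deriv u t) ^ 2) (1 / ε) :=
      integral_nonneg fun t => le_min (sq_nonneg _) (by positivity)
    unfold Fe at hF
    linarith
  have hE : ∃ x ∈ Icc a b, deriv u x ^ 2 = 1 / ε := by
    have hs : (1 / Real.sqrt ε) ^ 2 = 1 / ε := by rw [div_pow, Real.sq_sqrt hε.le, one_pow]
    rcases hend with h | h
    · exact ⟨a, ⟨le_rfl, hab.le⟩, by rw [← sq_abs, h, hs]⟩
    · exact ⟨b, ⟨hab.le, le_rfl⟩, by rw [← sq_abs, h, hs]⟩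
  obtain ⟨x, hx, hxe⟩ := hE
  have h1 := key x hx
  rw [hxe, show 2 * (k - 2) + 1 = 2 * k - 3 by omega] at h1
  have h2 : A * (V / (b - a)) ≤ 1 / (2 * ε) := by
    have : V / (b - a) ≤ 1 / (2 * A) / ε := by rw [div_le_iff₀ hL]; exact hV.le
    calc A * (V / (b - a)) ≤ A * (1 / (2 * A) / ε) := by gcongr
      _ = 1 / (2 * ε) := by field_simp
  have h3 : 1 / (2 * ε) ≤ A * ((b - a) ^ (2 * k - 3) * J) := by
    have : 1 / ε = 1 / (2 * ε) + 1 / (2 * ε) := by field_simp; norm_num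
    linarith
  have h4 : ε ^ (2 * k - 2) ≤ 2 * A * S * (b - a) ^ (2 * k - 3) := by
    have e : ε ^ (2 * k - 1) = ε ^ (2 * k - 2) * ε := by
      rw [← pow_succ]; congr 1; omega
    calc ε ^ (2 * k - 2) = 2 * ε ^ (2 * k - 1) * (1 / (2 * ε)) := by rw [e]; field_simp
      _ ≤ 2 * ε ^ (2 * k - 1) * (A * ((b - a) ^ (2 * k - 3) * J)) := by gcongr
      _ = 2 * A * (b - a) ^ (2 * k - 3) * (ε ^ (2 * k - 1) * J) := by ring
      _ ≤ 2 * A * (b - a) ^ (2 * k - 3) * S := by gcongr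
      _ = _ := by ring
  apply final_ineq k hk _ ε (b - a) (by positivity) (min_le_left _ _) hε hε1 hL
  calc min 1 (1 / (2 * A * S)) * ε ^ (2 * k - 2) ≤ 1 / (2 * A * S) * ε ^ (2 * k - 2) := by
        gcongr; exact min_le_right _ _
    _ ≤ 1 / (2 * A * S) * (2 * A * S * (b - a) ^ (2 * k - 3)) := by gcongr
    _ = _ := by field_simp
end

section
/- Let k ≥ 3 be an integer and S > 0, and let ℓ(k) = ⌊k/2⌋. There exist r ∈ (0,1) and C > 0, depending only on k and S, and for every integer N ≥ 1 a threshold ε₀ = ε₀(k,S,N) > 0, such that for every ε ∈ (0, ε₀), every function u that is k times continuously differentiable on a neighbourhood of [0,1] with F_ε(u; (0,1)) ≤ S, and every finite collection I_1, …, I_m of pairwise disjoint open subintervals of (0,1) each satisfying: (i) |u'(t)| < 1/√ε on I_j and |u'| = 1/√ε at at least one endpoint of I_j; (ii) ∫_{I_j} (u')² dt < (r/ε)|I_j|; (iii) the set { t ∈ I_j : |u^{(ℓ)}(t)| < 1/(N ε^ℓ) for all ℓ ∈ {1,…,ℓ(k)} } has Lebesgue measure zero; one has Σ_{j=1}^m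 |I_j| ≤ C N² ε^{k/(k−1)}. -/
open MeasureTheory Set

lemma cs_aux (g : ℝ → ℝ) (x y : ℝ) (hxy : x ≤ y) (hg : ContinuousOn g (Icc x y)) :
    (∫ t in x..y, g t) ^ 2 ≤ (y - x) * ∫ t in x..y, (g t) ^ 2 := by
  rcases hxy.eq_or_lt with rfl | hlt
  · simp
  have hg' : ContinuousOn g (uIcc x y) := by rwa [uIcc_of_le hxy]
  set J := ∫ t in x..y, g t with hJ
  set m := J / (y - x) with hm
  have h0 : 0 ≤ ∫ t in x..y, (g t - m) ^ 2 :=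
    intervalIntegral.integral_nonneg hxy (fun t _ => sq_nonneg _)
  have h1 : ∫ t in x..y, (g t - m) ^ 2 = (∫ t in x..y, (g t) ^ 2) - 2 * m * J + m ^ 2 * (y - x) := by
    have : ∀ t, (g t - m) ^ 2 = (g t) ^ 2 - 2 * m * g t + m ^ 2 := fun t => by ring
    simp_rw [this]
    rw [intervalIntegral.integral_add, intervalIntegral.integral_sub,
      intervalIntegral.integral_const_mul, intervalIntegral.integral_const]
    · simp only [smul_eq_mul]; rw [hJ]; ring
    · exact (hg'.pow 2).intervalIntegrable
    · exact (continuousOn_const.mul hg').intervalIntegrable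
    · exact ((hg'.pow 2).sub (continuousOn_const.mul hg')).intervalIntegrable
    · exact continuousOn_const.intervalIntegrable
  rw [h1] at h0
  have hp : 0 < y - x := by linarith
  have hmJ : m * (y - x) = J := by rw [hm]; field_simp
  nlinarith [mul_nonneg hp.le h0]

lemma sub_int_aux (g : ℝ → ℝ) (a b x y : ℝ) (hax : a ≤ x) (hxy : x ≤ y) (hyb : y ≤ b)
    (hg : ContinuousOn g (Icc a b)) :
    (∫ t in x..y, (g t) ^ 2) ≤ ∫ t in a..b, (g t) ^ 2 := by
  have hab : a ≤ b := by linarith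
  have hg' : ContinuousOn g (uIcc a b) := by rwa [uIcc_of_le hab]
  apply intervalIntegral.integral_mono_interval hax hxy hyb
  · exact Filter.Eventually.of_forall (fun t => sq_nonneg _)
  · exact (hg'.pow 2).intervalIntegrable

lemma exists_pt (j : ℕ) : ∃ C : ℝ, 0 < C ∧ ∀ (f : ℕ → ℝ → ℝ) (a b A : ℝ), a < b → 0 ≤ A →
    (∀ i < j, ∀ t ∈ Icc a b, HasDerivAt (f i) (f (i+1) t) t) → ContinuousOn (f 0) (Icc a b) →
    (∫ t in a..b, (f 0 t) ^ 2) ≤ A ^ 2 * (b - a) →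
    ∃ ξ ∈ Icc a b, |f j ξ| * (b - a) ^ j ≤ C * A := by
  induction j with
  | zero =>
    refine ⟨1, one_pos, fun f a b A hab hA _ hc hI => ?_⟩
    by_contra! hcon
    simp only [pow_zero, mul_one, one_mul] at hcon
    have : ∫ t in a..b, A ^ 2 < ∫ t in a..b, (f 0 t) ^ 2 := by
      have hlt : ∀ t ∈ Icc a b, A ^ 2 < (f 0 t) ^ 2 := fun t ht => by
        rw [← sq_abs (f 0 t)]
        have := hcon t ht
        nlinarith
      refine intervalIntegral.integral_lt_integral_of_continuousOn_of_le_of_exists_lt hab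
        continuousOn_const (hc.pow 2) (fun t ht => (hlt t (Ioc_subset_Icc_self ht)).le)
        ⟨a, left_mem_Icc.2 hab.le, hlt a (left_mem_Icc.2 hab.le)⟩
    rw [intervalIntegral.integral_const, smul_eq_mul] at this
    linarith
  | succ j ih =>
    obtain ⟨C, hC, ih⟩ := ih
    refine ⟨12 * 3 ^ j * C, by positivity, fun f a b A hab hA hd hc hI => ?_⟩
    set h := (b - a) / 3 with hh
    have hpos : 0 < h := by rw [hh]; linarith
    have hb : b = a + 3 * h := by rw [hh]; ring
    have key : ∀ x y, a ≤ x → x < y → y ≤ b → y - x = h →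
        ∃ ξ ∈ Icc x y, |f j ξ| * h ^ j ≤ C * (2 * A) := by
      intro x y hx hxy hy hyx
      have hsub : Icc x y ⊆ Icc a b := Icc_subset_Icc hx hy
      have := ih f x y (2 * A) hxy (by positivity)
        (fun i hi t ht => hd i (by omega) t (hsub ht)) (hc.mono hsub)
        (by
          refine (sub_int_aux (f 0) a b x y hx hxy.le hy hc).trans (hI.trans ?_)
          rw [hyx, hb]; nlinarith [mul_nonneg (sq_nonneg A) hpos.le])
      rwa [hyx] at this
    obtain ⟨x1, hx1, h1⟩ := key a (a + h) le_rfl (by linarith) (by linarith) (by ring)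
    obtain ⟨x2, hx2, h2⟩ := key (a + 2 * h) b (by linarith) (by linarith) le_rfl (by rw [hb]; ring)
    have hlt : x1 < x2 := by linarith [hx1.2, hx2.1]
    have hsub : Icc x1 x2 ⊆ Icc a b := Icc_subset_Icc hx1.1 hx2.2
    obtain ⟨ξ, hξ, he⟩ := exists_hasDerivAt_eq_slope (f j) (f (j+1)) hlt
      (fun t ht => (hd j (by omega) t (hsub ht)).continuousAt.continuousWithinAt)
      (fun t ht => hd j (by omega) t (hsub (Ioo_subset_Icc_self ht)))
    refine ⟨ξ, hsub (Ioo_subset_Icc_self hξ), ?_⟩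
    have hd' : h ≤ x2 - x1 := by linarith [hx1.2, hx2.1]
    have he' : |f (j+1) ξ| * (x2 - x1) = |f j x2 - f j x1| := by
      rw [he, abs_div, abs_of_pos (show 0 < x2 - x1 by linarith)]
      field_simp [show x2 - x1 ≠ 0 by linarith]
    have h3 : |f (j+1) ξ| * h ≤ |f j x2| + |f j x1| :=
      (mul_le_mul_of_nonneg_left hd' (abs_nonneg _)).trans (he' ▸ abs_sub _ _)
    have h4 : |f (j+1) ξ| * h * h ^ j ≤ 4 * C * A := by
      have := mul_le_mul_of_nonneg_right h3 (pow_pos hpos j).le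
      nlinarith
    have : (b - a) ^ (j+1) = 3 * 3 ^ j * (h * h ^ j) := by
      rw [show b - a = 3 * h by rw [hh]; ring, mul_pow, pow_succ, pow_succ]; ring
    rw [this]
    have h5 : (0:ℝ) < 3 * 3 ^ j := by positivity
    nlinarith [mul_le_mul_of_nonneg_left h4 h5.le]

lemma sup_bd (d : ℕ) : ∀ j : ℕ, ∃ C : ℝ, 0 < C ∧ ∀ (f : ℕ → ℝ → ℝ) (a b A B : ℝ), a < b →
    0 ≤ A → 0 ≤ B →
    (∀ i < j + d + 1, ∀ t ∈ Icc a b, HasDerivAt (f i) (f (i+1) t) t) →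
    ContinuousOn (f (j + d + 1)) (Icc a b) →
    (∫ t in a..b, (f 0 t) ^ 2) ≤ A ^ 2 * (b - a) →
    (∫ t in a..b, (f (j + d + 1) t) ^ 2) ≤ B ^ 2 * (b - a) →
    ∀ t ∈ Icc a b, |f j t| * (b - a) ^ j ≤ C * (A + B * (b - a) ^ (j + d + 1)) := by
  induction d with
  | zero =>
    intro j
    obtain ⟨C, hC, hpt⟩ := exists_pt j
    refine ⟨C + 1, by positivity, fun f a b A B hab hA hB hd hc hI hI2 t ht => ?_⟩
    simp only [add_zero] at *
    obtain ⟨ξ, hξ, h1⟩ := hpt f a b A hab hA (fun i hi => hd i (by omega))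
      (fun t ht => (hd 0 (by omega) t ht).continuousAt.continuousWithinAt) hI
    have hp : 0 < b - a := by linarith
    have main : ∀ x y, x ∈ Icc a b → y ∈ Icc a b → x ≤ y → |f j y - f j x| ≤ B * (b - a) := by
      intro x y hx hy hxy
      have hsub : Icc x y ⊆ Icc a b := Icc_subset_Icc hx.1 hy.2
      have e : ∫ t in x..y, f (j+1) t = f j y - f j x := by
        apply intervalIntegral.integral_eq_sub_of_hasDerivAt
        · intro t ht; rw [uIcc_of_le hxy] at ht; exact hd j (by omega) t (hsub ht)
        · apply ContinuousOn.intervalIntegrable; rw [uIcc_of_le hxy]; exact hc.mono hsub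
      have c := cs_aux (f (j+1)) x y hxy (hc.mono hsub)
      rw [e] at c
      have s := sub_int_aux (f (j+1)) a b x y hx.1 hxy hy.2 hc
      have hyx : y - x ≤ b - a := by linarith [hx.1, hy.2]
      apply abs_le_of_sq_le_sq _ (by positivity)
      calc _ ≤ _ := c
        _ ≤ (b - a) * (B ^ 2 * (b - a)) :=
          mul_le_mul hyx (s.trans hI2)
            (intervalIntegral.integral_nonneg hxy (fun t _ => sq_nonneg _)) hp.le
        _ = _ := by ring
    have h2 : |f j t - f j ξ| ≤ B * (b - a) := by
      rcases le_total ξ t with h | h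
      · exact main _ _ hξ ht h
      · rw [abs_sub_comm]; exact main _ _ ht hξ h
    have h3 : |f j t| ≤ |f j ξ| + B * (b - a) := by
      have := abs_sub_abs_le_abs_sub (f j t) (f j ξ); linarith
    have hpj : 0 < (b - a) ^ j := by positivity
    have hB' : 0 ≤ B * (b - a) ^ (j+1) := by positivity
    calc |f j t| * (b - a) ^ j ≤ (|f j ξ| + B * (b - a)) * (b - a) ^ j :=
          mul_le_mul_of_nonneg_right h3 hpj.le
      _ = |f j ξ| * (b - a) ^ j + B * (b - a) ^ (j+1) := by ring
      _ ≤ _ := by nlinarith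
  | succ d ih =>
    intro j
    obtain ⟨C, hC, hpt⟩ := exists_pt j
    obtain ⟨C', hC', ih⟩ := ih (j+1)
    refine ⟨C + C', by positivity, fun f a b A B hab hA hB hd hc hI hI2 t ht => ?_⟩
    have ee : j + 1 + d + 1 = j + (d + 1) + 1 := by ring
    rw [ee] at ih
    obtain ⟨ξ, hξ, h1⟩ := hpt f a b A hab hA (fun i hi => hd i (by omega))
      (fun t ht => (hd 0 (by omega) t ht).continuousAt.continuousWithinAt) hI
    have hp : 0 < b - a := by linarith
    have hs := ih f a b A B hab hA hB hd hc hI hI2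
    set K := A + B * (b - a) ^ (j + (d+1) + 1) with hK
    have hpj : 0 < (b - a) ^ j := by positivity
    have hpj1 : 0 < (b - a) ^ (j+1) := by positivity
    have h2 : |f j t - f j ξ| ≤ (C' * K / (b - a) ^ (j+1)) * |t - ξ| := by
      have := Convex.norm_image_sub_le_of_norm_hasDerivWithin_le (f := f j) (f' := f (j+1))
        (s := Icc a b) (x := ξ) (y := t) (C := C' * K / (b - a) ^ (j+1))
        (fun x hx => (hd j (by omega) x hx).hasDerivWithinAt)
        (fun x hx => by rw [Real.norm_eq_abs, le_div_iff₀ hpj1]; exact hs x hx)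
        (convex_Icc a b) hξ ht
      simpa [Real.norm_eq_abs] using this
    have hK0 : 0 ≤ B * (b - a) ^ (j + (d+1) + 1) := by positivity
    have hK1 : 0 ≤ K := by positivity
    have h4 : |t - ξ| ≤ b - a := by
      rw [abs_le]; constructor <;> linarith [hξ.1, hξ.2, ht.1, ht.2]
    have h5 : |f j t| ≤ |f j ξ| + (C' * K / (b - a) ^ (j+1)) * (b - a) := by
      have := abs_sub_abs_le_abs_sub (f j t) (f j ξ)
      have := mul_le_mul_of_nonneg_left h4 (show 0 ≤ C' * K / (b - a) ^ (j+1) by positivity)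
      linarith
    calc |f j t| * (b - a) ^ j ≤ (|f j ξ| + (C' * K / (b - a) ^ (j+1)) * (b - a)) * (b - a) ^ j :=
          mul_le_mul_of_nonneg_right h5 hpj.le
      _ = |f j ξ| * (b - a) ^ j + C' * K := by field_simp; ring
      _ ≤ C * A + C' * K := by linarith
      _ ≤ C * K + C' * K := by nlinarith
      _ = _ := by ring

/-- pointwise squared estimate -/
lemma pw_sq (n j : ℕ) (hj : j < n) : ∃ C : ℝ, 0 < C ∧ ∀ (f : ℕ → ℝ → ℝ) (a b : ℝ), a < b →
    (∀ i < n, ∀ t ∈ Icc a b, HasDerivAt (f i) (f (i+1) t) t) →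
    ContinuousOn (f n) (Icc a b) →
    ∀ t ∈ Icc a b, (f j t) ^ 2 * (b - a) ^ (2 * j) * (b - a) ≤
      C * ((∫ t in a..b, (f 0 t) ^ 2) + (b - a) ^ (2 * n) * ∫ t in a..b, (f n t) ^ 2) := by
  obtain ⟨d, rfl⟩ : ∃ d, n = j + d + 1 := ⟨n - j - 1, by omega⟩
  obtain ⟨C, hC, h⟩ := sup_bd d j
  refine ⟨2 * C ^ 2, by positivity, fun f a b hab hd hc t ht => ?_⟩
  have hp : 0 < b - a := by linarith
  set n := j + d + 1
  set X := ∫ t in a..b, (f 0 t) ^ 2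
  set Y := ∫ t in a..b, (f n t) ^ 2
  have hX : 0 ≤ X := intervalIntegral.integral_nonneg hab.le (fun t _ => sq_nonneg _)
  have hY : 0 ≤ Y := intervalIntegral.integral_nonneg hab.le (fun t _ => sq_nonneg _)
  have hA : Real.sqrt (X / (b - a)) ^ 2 * (b - a) = X := by
    rw [Real.sq_sqrt (by positivity)]; field_simp
  have hB : Real.sqrt (Y / (b - a)) ^ 2 * (b - a) = Y := by
    rw [Real.sq_sqrt (by positivity)]; field_simp
  have := h f a b (Real.sqrt (X / (b - a))) (Real.sqrt (Y / (b - a))) hab (Real.sqrt_nonneg _)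
    (Real.sqrt_nonneg _) hd hc hA.ge hB.ge t ht
  set A := Real.sqrt (X / (b - a))
  set B := Real.sqrt (Y / (b - a))
  have h2 := pow_le_pow_left₀ (by positivity) this 2
  rw [mul_pow, sq_abs, ← pow_mul, mul_comm j 2] at h2
  calc (f j t) ^ 2 * (b - a) ^ (2 * j) * (b - a) ≤ (C * (A + B * (b - a) ^ n)) ^ 2 * (b - a) :=
        mul_le_mul_of_nonneg_right h2 hp.le
    _ ≤ C ^ 2 * (2 * (A ^ 2 + (B * (b - a) ^ n) ^ 2)) * (b - a) := by
        apply mul_le_mul_of_nonneg_right _ hp.le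
        rw [mul_pow]
        apply mul_le_mul_of_nonneg_left _ (by positivity)
        nlinarith [sq_nonneg (A - B * (b - a) ^ n)]
    _ = 2 * C ^ 2 * (A ^ 2 * (b - a) + (b - a) ^ (2 * n) * (B ^ 2 * (b - a))) := by ring
    _ = _ := by rw [hA, hB]

lemma int_sq (n j : ℕ) (hj : j < n) : ∃ C : ℝ, 0 < C ∧ ∀ (f : ℕ → ℝ → ℝ) (a b : ℝ), a < b →
    (∀ i < n, ∀ t ∈ Icc a b, HasDerivAt (f i) (f (i+1) t) t) →
    ContinuousOn (f n) (Icc a b) →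
    (b - a) ^ (2 * j) * (∫ t in a..b, (f j t) ^ 2) ≤
      C * ((∫ t in a..b, (f 0 t) ^ 2) + (b - a) ^ (2 * n) * ∫ t in a..b, (f n t) ^ 2) := by
  obtain ⟨C, hC, h⟩ := pw_sq n j hj
  refine ⟨C, hC, fun f a b hab hd hc => ?_⟩
  have hp : 0 < b - a := by linarith
  have := h f a b hab hd hc
  set R := C * ((∫ t in a..b, (f 0 t) ^ 2) + (b - a) ^ (2 * n) * ∫ t in a..b, (f n t) ^ 2)
  have hcj : ContinuousOn (f j) (Icc a b) :=
    fun t ht => (hd j hj t ht).continuousAt.continuousWithinAt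
  have hi : (∫ t in a..b, (f j t) ^ 2) ≤ ∫ t in a..b, R / ((b - a) ^ (2 * j) * (b - a)) := by
    apply intervalIntegral.integral_mono_on hab.le
    · apply ContinuousOn.intervalIntegrable; rw [uIcc_of_le hab.le]; exact hcj.pow 2
    · exact continuousOn_const.intervalIntegrable
    · intro t ht
      rw [le_div_iff₀ (by positivity), ← mul_assoc]; exact this t ht
  rw [intervalIntegral.integral_const, smul_eq_mul] at hi
  calc _ ≤ _ := mul_le_mul_of_nonneg_left hi (by positivity)
    _ = R := by field_simp

lemma tile (n j : ℕ) (hj : j < n) : ∃ C : ℝ, 0 < C ∧ ∀ (f : ℕ → ℝ → ℝ) (a b δ : ℝ), a < b →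
    0 < δ → δ ≤ b - a →
    (∀ i < n, ∀ t ∈ Icc a b, HasDerivAt (f i) (f (i+1) t) t) →
    ContinuousOn (f n) (Icc a b) →
    δ ^ (2 * j) * (∫ t in a..b, (f j t) ^ 2) ≤
      C * ((∫ t in a..b, (f 0 t) ^ 2) + δ ^ (2 * n) * ∫ t in a..b, (f n t) ^ 2) := by
  obtain ⟨C, hC, h⟩ := int_sq n j hj
  refine ⟨C * 2 ^ (2 * n), by positivity, fun f a b δ hab hδ hδL hd hc => ?_⟩
  have hcont : ∀ i ≤ n, ContinuousOn (f i) (Icc a b) := by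
    intro i hi
    rcases hi.lt_or_eq with hi | rfl
    · exact fun t ht => (hd i hi t ht).continuousAt.continuousWithinAt
    · exact hc
  set M := ⌊(b - a) / δ⌋₊ with hM
  have hM1 : 1 ≤ M := by
    rw [hM, Nat.one_le_floor_iff, le_div_iff₀ hδ]; linarith
  have hM1' : (1:ℝ) ≤ M := by exact_mod_cast hM1
  have hM2 : (M:ℝ) * δ ≤ b - a := by
    rw [← le_div_iff₀ hδ]; apply Nat.floor_le; apply div_nonneg <;> linarith
  have hM3 : b - a < (M + 1) * δ := by
    rw [← div_lt_iff₀ hδ]; exact Nat.lt_floor_add_one _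
  set η := (b - a) / M with hη
  have hηM : η * M = b - a := by rw [hη]; field_simp
  have hη1 : δ ≤ η := by rw [hη, le_div_iff₀ (by linarith)]; linarith
  have hη2 : η ≤ 2 * δ := by rw [hη, div_le_iff₀ (by linarith)]; nlinarith
  have hη0 : 0 < η := by linarith
  set p : ℕ → ℝ := fun i => a + i * η with hpdef
  have hp0 : p 0 = a := by simp [hpdef]
  have hpM : p M = b := by simp only [hpdef]; linarith
  have hpstep : ∀ i, p (i+1) - p i = η := fun i => by simp only [hpdef]; push_cast; ring
  have hpsub : ∀ i < M, Icc (p i) (p (i+1)) ⊆ Icc a b := by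
    intro i hi
    apply Icc_subset_Icc
    · simp only [hpdef]; have : 0 ≤ (i:ℝ) * η := by positivity
      linarith
    · rw [← hpM]; simp only [hpdef]
      have : ((i+1 : ℕ):ℝ) ≤ M := by exact_mod_cast hi
      nlinarith
  have hsum : ∀ i ≤ n, ∑ q ∈ Finset.range M, ∫ t in (p q)..(p (q+1)), (f i t) ^ 2
      = ∫ t in a..b, (f i t) ^ 2 := by
    intro i hi
    rw [← hp0, ← hpM]
    apply intervalIntegral.sum_integral_adjacent_intervals
    intro q hq
    apply ContinuousOn.intervalIntegrable
    rw [uIcc_of_le (by linarith [hpstep q])]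
    exact ((hcont i hi).mono (hpsub q hq)).pow 2
  rw [← hsum j hj.le, ← hsum 0 (by omega), ← hsum n le_rfl, Finset.mul_sum, Finset.mul_sum,
    ← Finset.sum_add_distrib, Finset.mul_sum]
  apply Finset.sum_le_sum
  intro q hq
  rw [Finset.mem_range] at hq
  have hlt : p q < p (q+1) := by linarith [hpstep q]
  have hq' := h f (p q) (p (q+1)) hlt (fun i hi t ht => hd i hi t (hpsub q hq ht))
    (hc.mono (hpsub q hq))
  rw [hpstep] at hq'
  have nn : ∀ i, 0 ≤ ∫ t in (p q)..(p (q+1)), (f i t) ^ 2 := fun i =>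
    intervalIntegral.integral_nonneg hlt.le (fun t _ => sq_nonneg _)
  calc δ ^ (2 * j) * (∫ t in (p q)..(p (q+1)), (f j t) ^ 2)
      ≤ η ^ (2 * j) * (∫ t in (p q)..(p (q+1)), (f j t) ^ 2) :=
        mul_le_mul_of_nonneg_right (pow_le_pow_left₀ hδ.le hη1 _) (nn j)
    _ ≤ _ := hq'
    _ ≤ C * (2 ^ (2 * n) * (∫ t in (p q)..(p (q+1)), (f 0 t) ^ 2)
          + (2 * δ) ^ (2 * n) * ∫ t in (p q)..(p (q+1)), (f n t) ^ 2) := by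
        apply mul_le_mul_of_nonneg_left _ hC.le
        apply add_le_add
        · exact le_mul_of_one_le_left (nn 0) (one_le_pow₀ (by norm_num))
        · exact mul_le_mul_of_nonneg_right (pow_le_pow_left₀ hη0.le hη2 _) (nn n)
    _ = _ := by rw [mul_pow]; ring

/-- combined estimate -/
lemma comb (n j : ℕ) (hj : j < n) : ∃ C : ℝ, 0 < C ∧ ∀ (f : ℕ → ℝ → ℝ) (a b δ K : ℝ), a < b →
    0 < δ → 0 ≤ K →
    (∀ i < n, ∀ t ∈ Icc a b, HasDerivAt (f i) (f (i+1) t) t) →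
    ContinuousOn (f n) (Icc a b) →
    ((∫ t in a..b, (f 0 t) ^ 2) ≤ K * ((b - a) ^ (2 * n) * ∫ t in a..b, (f n t) ^ 2)) →
    δ ^ (2 * j) * (∫ t in a..b, (f j t) ^ 2) ≤
      C * (K + 1) * ((∫ t in a..b, (f 0 t) ^ 2) + δ ^ (2 * n) * ∫ t in a..b, (f n t) ^ 2) := by
  obtain ⟨C1, hC1, h1⟩ := tile n j hj
  obtain ⟨C2, hC2, h2⟩ := int_sq n j hj
  refine ⟨C1 + C2, by positivity, fun f a b δ K hab hδ hK hd hc hk => ?_⟩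
  have hp : 0 < b - a := by linarith
  have nn : ∀ i, 0 ≤ ∫ t in a..b, (f i t) ^ 2 := fun i =>
    intervalIntegral.integral_nonneg hab.le (fun t _ => sq_nonneg _)
  have n0 := nn 0
  have nN := nn n
  have nj := nn j
  rcases le_or_gt δ (b - a) with hle | hgt
  · refine (h1 f a b δ hab hδ hle hd hc).trans ?_
    apply mul_le_mul_of_nonneg_right _ (by positivity)
    nlinarith [mul_nonneg hC1.le hK, mul_nonneg hC2.le hK]
  · have h2 := h2 f a b hab hd hc
    set X := ∫ t in a..b, (f 0 t) ^ 2
    set Y := ∫ t in a..b, (f n t) ^ 2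
    set Z := ∫ t in a..b, (f j t) ^ 2
    obtain ⟨e, rfl⟩ : ∃ e, n = j + e := ⟨n - j, by omega⟩
    have h3 : (b - a) ^ (2 * j) * Z ≤ (b - a) ^ (2 * j) * (C2 * (K + 1) * ((b - a) ^ (2 * e) * Y)) := by
      refine h2.trans ?_
      have : (b - a) ^ (2 * j) * (C2 * (K + 1) * ((b - a) ^ (2 * e) * Y))
        = C2 * (K * ((b - a) ^ (2 * (j + e)) * Y) + (b - a) ^ (2 * (j + e)) * Y) := by ring
      rw [this]
      apply mul_le_mul_of_nonneg_left _ hC2.le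
      linarith
    have h4 := le_of_mul_le_mul_left h3 (by positivity)
    have h5 : (b - a) ^ (2 * e) ≤ δ ^ (2 * e) := pow_le_pow_left₀ hp.le hgt.le _
    calc δ ^ (2 * j) * Z ≤ δ ^ (2 * j) * (C2 * (K + 1) * (δ ^ (2 * e) * Y)) := by
          apply mul_le_mul_of_nonneg_left _ (by positivity)
          refine h4.trans ?_
          apply mul_le_mul_of_nonneg_left _ (by positivity)
          exact mul_le_mul_of_nonneg_right h5 nN
      _ = C2 * (K + 1) * (δ ^ (2 * (j + e)) * Y) := by ring
      _ ≤ (C1 + C2) * (K + 1) * (X + δ ^ (2 * (j + e)) * Y) := by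
          apply mul_le_mul _ (by linarith) (by positivity) (by positivity)
          apply mul_le_mul_of_nonneg_right _ (by positivity)
          linarith

/-- the small-average condition gives a Poincare type bound -/
lemma poinc (n : ℕ) (hn : 0 < n) : ∃ r ∈ Ioo (0:ℝ) 1, ∃ K : ℝ, 0 < K ∧
    ∀ (f : ℕ → ℝ → ℝ) (a b E : ℝ), a < b → 0 < E →
    (∀ i < n, ∀ t ∈ Icc a b, HasDerivAt (f i) (f (i+1) t) t) →
    ContinuousOn (f n) (Icc a b) →
    (∃ t ∈ Icc a b, (f 0 t) ^ 2 = E) →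
    (∫ t in a..b, (f 0 t) ^ 2) ≤ r * E * (b - a) →
    (∫ t in a..b, (f 0 t) ^ 2) ≤ K * ((b - a) ^ (2 * n) * ∫ t in a..b, (f n t) ^ 2) := by
  obtain ⟨C, hC, h⟩ := pw_sq n 0 hn
  refine ⟨1 / (2 * (C + 1)), ⟨by positivity, ?_⟩, C, hC, ?_⟩
  · rw [div_lt_one (by positivity)]; linarith
  intro f a b E hab hE hd hc ⟨t, ht, hte⟩ hI
  have hp : 0 < b - a := by linarith
  have h1 := h f a b hab hd hc t ht
  rw [hte] at h1
  simp only [mul_zero, pow_zero, mul_one] at h1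
  set X := ∫ t in a..b, (f 0 t) ^ 2
  set W := (b - a) ^ (2 * n) * ∫ t in a..b, (f n t) ^ 2
  have h2 : 2 * (C + 1) * X ≤ E * (b - a) := by
    have := mul_le_mul_of_nonneg_left hI (show 0 ≤ 2 * (C + 1) by positivity)
    refine this.trans (le_of_eq ?_)
    field_simp
  have hX : 0 ≤ X := intervalIntegral.integral_nonneg hab.le (fun t _ => sq_nonneg _)
  have := mul_nonneg hC.le hX
  linarith

lemma scale_aux (k : ℕ) (hk : 3 ≤ k) (ε : ℝ) (h0 : 0 < ε) (h1 : ε < 1) :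
    ∃ δ : ℝ, 0 < δ ∧ δ ^ (2 * (k - 1)) = ε ^ (2 * k - 1) ∧
      ∀ j : ℕ, j + 2 ≤ k →
        ε ^ (2 * (j + 1)) ≤ ε ^ ((k:ℝ) / ((k:ℝ) - 1)) * δ ^ (2 * j) := by
  obtain ⟨q, rfl⟩ : ∃ q, k = q + 1 := ⟨k - 1, by omega⟩
  have hq : (0:ℝ) < q := by exact_mod_cast (show 0 < q by omega)
  refine ⟨ε ^ ((2 * (q:ℝ) + 1) / (2 * q)), by positivity, ?_, ?_⟩
  · rw [← Real.rpow_natCast, ← Real.rpow_mul h0.le, ← Real.rpow_natCast ε]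
    congr 1
    rw [show 2 * (q + 1) - 1 = 2 * q + 1 by omega, show q + 1 - 1 = q by omega]
    push_cast
    field_simp
  · intro j hj
    rw [← Real.rpow_natCast, ← Real.rpow_natCast, ← Real.rpow_mul h0.le, ← Real.rpow_add h0]
    apply Real.rpow_le_rpow_of_exponent_ge h0 h1.le
    push_cast
    have hj' : (j:ℝ) + 1 ≤ q := by exact_mod_cast (show j + 1 ≤ q by omega)
    have : ((q:ℝ) + 1) / (q + 1 - 1) + (2 * q + 1) / (2 * q) * (2 * j)
      = (q + 1 + (2 * q + 1) * j) / q := by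
      rw [add_sub_cancel_right]; field_simp
    rw [this, div_le_iff₀ hq]
    nlinarith

lemma deriv_facts (k : ℕ) (u : ℝ → ℝ) (U : Set ℝ) (hU : IsOpen U)
    (hu : ContDiffOn ℝ k u U) :
    (∀ i < k, ∀ t ∈ U, HasDerivAt (iteratedDeriv i u) (iteratedDeriv (i+1) u t) t) ∧
    (∀ i ≤ k, ContinuousOn (iteratedDeriv i u) U) := by
  constructor
  · intro i hi t ht
    have h := hu.differentiableOn_iteratedDerivWithin (m := i) (by exact_mod_cast hi) hU.uniqueDiffOn
    have h2 : DifferentiableOn ℝ (iteratedDeriv i u) U :=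
      h.congr (fun x hx => (iteratedDerivWithin_of_isOpen hU hx).symm)
    rw [iteratedDeriv_succ]
    exact (h2.differentiableAt (hU.mem_nhds ht)).hasDerivAt
  · intro i hi
    have h := hu.continuousOn_iteratedDerivWithin (m := i) (by exact_mod_cast hi) hU.uniqueDiffOn
    exact h.congr (fun x hx => (iteratedDerivWithin_of_isOpen hU hx).symm)

/-- Chebyshev step -/
lemma cheb (p N : ℕ) (hN : 1 ≤ N) (ε : ℝ) (h0 : 0 < ε) (f : ℕ → ℝ → ℝ) (a b : ℝ) (hab : a < b)
    (hc : ∀ j < p, ContinuousOn (f j) (Icc a b))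
    (hv : volume {t ∈ Ioo a b | ∀ j < p, |f j t| < 1 / ((N:ℝ) * ε ^ (j+1))} = 0) :
    b - a ≤ (N:ℝ) ^ 2 * ∑ j ∈ Finset.range p, ε ^ (2 * (j+1)) * ∫ t in a..b, (f j t) ^ 2 := by
  have hN' : (0:ℝ) < N := by exact_mod_cast hN
  have hii : ∀ j ∈ Finset.range p, IntervalIntegrable
      (fun t => ε ^ (2 * (j+1)) * (f j t) ^ 2) volume a b := by
    intro j hj
    apply ContinuousOn.intervalIntegrable
    rw [uIcc_of_le hab.le]
    exact continuousOn_const.mul ((hc j (Finset.mem_range.1 hj)).pow 2)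
  have e : (N:ℝ) ^ 2 * ∑ j ∈ Finset.range p, ε ^ (2 * (j+1)) * ∫ t in a..b, (f j t) ^ 2
      = ∫ t in a..b, (N:ℝ) ^ 2 * ∑ j ∈ Finset.range p, ε ^ (2 * (j+1)) * (f j t) ^ 2 := by
    rw [intervalIntegral.integral_const_mul, intervalIntegral.integral_finset_sum hii]
    simp_rw [intervalIntegral.integral_const_mul]
  rw [e]
  have e1 : b - a = ∫ t in a..b, (1:ℝ) := by simp
  rw [e1, intervalIntegral.integral_of_le hab.le, intervalIntegral.integral_of_le hab.le,
    integral_Ioc_eq_integral_Ioo, integral_Ioc_eq_integral_Ioo]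
  apply integral_mono_ae
  · exact integrable_const _
  · have := (IntervalIntegrable.sum (Finset.range p) hii).const_mul ((N:ℝ)^2)
    rw [intervalIntegrable_iff_integrableOn_Ioo_of_le hab.le] at this
    refine this.congr ?_
    filter_upwards with t
    simp
  · have hae : ∀ᵐ t, t ∉ {t ∈ Ioo a b | ∀ j < p, |f j t| < 1 / ((N:ℝ) * ε ^ (j+1))} :=
      measure_eq_zero_iff_ae_notMem.1 hv
    filter_upwards [ae_restrict_of_ae hae, ae_restrict_mem measurableSet_Ioo] with t ht htI
    have : ∃ j < p, 1 / ((N:ℝ) * ε ^ (j+1)) ≤ |f j t| := by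
      by_contra! hcon
      exact ht ⟨htI, hcon⟩
    obtain ⟨j, hj, hle⟩ := this
    rw [div_le_iff₀ (by positivity)] at hle
    have h2 : 1 ≤ (N:ℝ) ^ 2 * (ε ^ (2 * (j+1)) * (f j t) ^ 2) := by
      have := one_le_pow₀ hle (n := 2)
      rw [mul_pow, sq_abs] at this
      refine this.trans (le_of_eq ?_)
      ring
    refine h2.trans (mul_le_mul_of_nonneg_left ?_ (by positivity))
    exact Finset.single_le_sum (f := fun j => ε ^ (2 * (j+1)) * (f j t) ^ 2)
      (fun i _ => by positivity) (Finset.mem_range.2 hj)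

lemma energy_sum (k : ℕ) (hk : 1 ≤ k) (S ε : ℝ) (h0 : 0 < ε) (u : ℝ → ℝ)
    (hc1 : ContinuousOn (deriv u) (Icc 0 1)) (hck : ContinuousOn (iteratedDeriv k u) (Icc 0 1))
    (hF : Fe k ε u 0 1 ≤ S) (m : ℕ) (aa bb : Fin m → ℝ) (hab : ∀ i, aa i < bb i)
    (h01 : ∀ i, 0 ≤ aa i ∧ bb i ≤ 1)
    (hdis : ∀ i j, i ≠ j → Disjoint (Ioo (aa i) (bb i)) (Ioo (aa j) (bb j)))
    (hlt : ∀ i, ∀ t ∈ Ioo (aa i) (bb i), |deriv u t| < 1 / Real.sqrt ε) :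
    ∑ i, ((∫ t in (aa i)..(bb i), (deriv u t) ^ 2) +
      ε ^ (2 * k - 1) * ∫ t in (aa i)..(bb i), (iteratedDeriv k u t) ^ 2) ≤ S := by
  refine le_trans ?_ hF
  have i1 : IntegrableOn (fun t => min ((deriv u t) ^ 2) (1 / ε)) (Ioo 0 1) :=
    (ContinuousOn.integrableOn_Icc ((hc1.pow 2).inf continuousOn_const)).mono_set Ioo_subset_Icc_self
  have i2 : IntegrableOn (fun t => (iteratedDeriv k u t) ^ 2) (Ioo 0 1) :=
    (ContinuousOn.integrableOn_Icc (hck.pow 2)).mono_set Ioo_subset_Icc_self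
  have hsub : ∀ i, Ioo (aa i) (bb i) ⊆ Ioo 0 1 := fun i => Ioo_subset_Ioo (h01 i).1 (h01 i).2
  have gen : ∀ g : ℝ → ℝ, IntegrableOn g (Ioo 0 1) → (∀ t, 0 ≤ g t) →
      ∑ i, ∫ t in Ioo (aa i) (bb i), g t ≤ ∫ t in Ioo 0 1, g t := by
    intro g hg hpos
    rw [← integral_iUnion_fintype (fun i => measurableSet_Ioo) (fun i j hij => hdis i j hij)
      (fun i => hg.mono_set (hsub i))]
    apply setIntegral_mono_set hg
    · exact Filter.Eventually.of_forall hpos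
    · exact (iUnion_subset hsub).eventuallyLE
  unfold Fe
  rw [Finset.sum_add_distrib, ← Finset.mul_sum]
  simp_rw [fun i => intervalIntegral.integral_of_le (μ := volume) (f := fun t => (deriv u t)^2) (hab i).le,
    fun i => intervalIntegral.integral_of_le (μ := volume) (f := fun t => (iteratedDeriv k u t)^2) (hab i).le,
    integral_Ioc_eq_integral_Ioo]
  apply add_le_add
  · refine le_trans (le_of_eq ?_) (gen _ i1 (fun t => by positivity))
    apply Finset.sum_congr rfl
    intro i _
    apply setIntegral_congr_fun measurableSet_Ioo
    intro t ht
    have := hlt i t ht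
    have h2 := pow_le_pow_left₀ (abs_nonneg _) this.le 2
    rw [sq_abs, div_pow, Real.sq_sqrt h0.le, one_pow] at h2
    exact (min_eq_left h2).symm
  · exact mul_le_mul_of_nonneg_left (gen _ i2 (fun t => by positivity)) (by positivity)

/-- Lemma 4.9 of the paper: total length estimate for the `small' intervals
that avoid points where all derivatives of order `1,…,ℓ(k)` (with `ℓ(k) = ⌊k/2⌋`) are below
the thresholds: for `ε` below a threshold depending on `k`, `S`, `N`, the sum of the lengths
of any finite disjoint family of such subintervals of `(0,1)` is at most
`C N² ε^{k/(k-1)}`. -/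
theorem total_length_small_intervals (k : ℕ) (hk : 3 ≤ k) (S : ℝ) (hS : 0 < S) :
    ∃ r ∈ Ioo (0:ℝ) 1, ∃ C : ℝ, 0 < C ∧
      ∀ N : ℕ, 1 ≤ N → ∃ ε₀ : ℝ, 0 < ε₀ ∧
      ∀ ε ∈ Ioo (0:ℝ) ε₀,
      ∀ u : ℝ → ℝ,
        (∃ U : Set ℝ, IsOpen U ∧ Icc (0:ℝ) 1 ⊆ U ∧ ContDiffOn ℝ k u U) →
        Fe k ε u 0 1 ≤ S →
      ∀ (m : ℕ) (aa bb : Fin m → ℝ),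
        (∀ i, aa i < bb i) →
        (∀ i, 0 ≤ aa i ∧ bb i ≤ 1) →
        (∀ i j, i ≠ j → Disjoint (Ioo (aa i) (bb i)) (Ioo (aa j) (bb j))) →
        (∀ i, ∀ t ∈ Ioo (aa i) (bb i), |deriv u t| < 1 / Real.sqrt ε) →
        (∀ i, |deriv u (aa i)| = 1 / Real.sqrt ε ∨ |deriv u (bb i)| = 1 / Real.sqrt ε) →
        (∀ i, (∫ t in Ioo (aa i) (bb i), (deriv u t) ^ 2) < r / ε * (bb i - aa i)) →
        (∀ i, volume {t ∈ Ioo (aa i) (bb i) |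
          ∀ ℓ : ℕ, 1 ≤ ℓ → ℓ ≤ k / 2 → |iteratedDeriv ℓ u t| < 1 / ((N:ℝ) * ε ^ ℓ)} = 0) →
        (∑ i, (bb i - aa i)) ≤ C * (N:ℝ) ^ 2 * ε ^ ((k:ℝ) / ((k:ℝ) - 1)) := by
  obtain ⟨r, hr, K, hK, hpo⟩ := poinc (k - 1) (by omega)
  have hcomb : ∀ j, ∃ C : ℝ, 0 < C ∧ (j < k - 1 → ∀ (f : ℕ → ℝ → ℝ) (a b δ K : ℝ), a < b →
    0 < δ → 0 ≤ K →
    (∀ i < k - 1, ∀ t ∈ Icc a b, HasDerivAt (f i) (f (i+1) t) t) →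
    ContinuousOn (f (k - 1)) (Icc a b) →
    ((∫ t in a..b, (f 0 t) ^ 2) ≤ K * ((b - a) ^ (2 * (k - 1)) * ∫ t in a..b, (f (k - 1) t) ^ 2)) →
    δ ^ (2 * j) * (∫ t in a..b, (f j t) ^ 2) ≤
      C * (K + 1) * ((∫ t in a..b, (f 0 t) ^ 2)
        + δ ^ (2 * (k - 1)) * ∫ t in a..b, (f (k - 1) t) ^ 2)) := by
    intro j
    by_cases hj : j < k - 1
    · obtain ⟨C, hC, h⟩ := comb (k - 1) j hj
      exact ⟨C, hC, fun _ => h⟩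
    · exact ⟨1, one_pos, fun h => absurd h hj⟩
  choose Cc hCc hcomb using hcomb
  have hsC : 0 < (∑ j ∈ Finset.range (k / 2), Cc j) :=
    Finset.sum_pos (fun j _ => hCc j) ⟨0, Finset.mem_range.2 (by omega)⟩
  refine ⟨r, hr, (∑ j ∈ Finset.range (k / 2), Cc j) * (K + 1) * S, by positivity, ?_⟩
  intro N hN
  refine ⟨1, one_pos, ?_⟩
  rintro ε ⟨h0, h1⟩ u ⟨U, hU, hsubU, hu⟩ hF m aa bb hab h01 hdis hlt hend hsmall hvol
  obtain ⟨δ, hδ, hδe, hδj⟩ := scale_aux k hk ε h0 h1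
  obtain ⟨hder, hcon⟩ := deriv_facts k u U hU hu
  set f : ℕ → ℝ → ℝ := fun j => iteratedDeriv (j+1) u with hf
  have hf0 : f 0 = deriv u := by simp [hf, iteratedDeriv_one]
  have hfn : f (k - 1) = iteratedDeriv k u := by
    simp only [hf]; rw [show k - 1 + 1 = k by omega]
  have hes := energy_sum k (by omega) S ε h0 u
    (by rw [← hf0]; exact (hcon 1 (by omega)).mono hsubU) ((hcon k le_rfl).mono hsubU)
    hF m aa bb hab h01 hdis hlt
  set P := ε ^ ((k:ℝ) / ((k:ℝ) - 1)) with hP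
  have hP0 : 0 < P := by positivity
  set E : Fin m → ℝ := fun i => (∫ t in (aa i)..(bb i), (deriv u t) ^ 2) +
      ε ^ (2 * k - 1) * ∫ t in (aa i)..(bb i), (iteratedDeriv k u t) ^ 2 with hE
  have key : ∀ i, bb i - aa i ≤
      ((∑ j ∈ Finset.range (k / 2), Cc j) * (K + 1) * (N:ℝ) ^ 2 * P) * E i := by
    intro i
    have hsI : Icc (aa i) (bb i) ⊆ U :=
      (Icc_subset_Icc (h01 i).1 (h01 i).2).trans hsubU
    have hd : ∀ j < k - 1, ∀ t ∈ Icc (aa i) (bb i), HasDerivAt (f j) (f (j+1) t) t :=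
      fun j hj t ht => hder (j+1) (by omega) t (hsI ht)
    have hcn : ContinuousOn (f (k - 1)) (Icc (aa i) (bb i)) :=
      (hcon (k - 1 + 1) (by omega)).mono hsI
    have hch := cheb (k / 2) N hN ε h0 f (aa i) (bb i) (hab i)
      (fun j hj => (hcon (j+1) (by omega)).mono hsI) (by
        refine measure_mono_null ?_ (hvol i)
        rintro t ⟨ht, h⟩
        refine ⟨ht, fun l hl1 hl2 => ?_⟩
        have := h (l - 1) (by omega)
        simp only [hf] at this
        rwa [show l - 1 + 1 = l by omega] at this)
    have hpoi := hpo f (aa i) (bb i) (1 / ε) (hab i) (by positivity) hd hcn (by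
        have hsq : ∀ t, |deriv u t| = 1 / Real.sqrt ε → (f 0 t) ^ 2 = 1 / ε := by
          intro t ht
          rw [hf0, ← sq_abs, ht, div_pow, Real.sq_sqrt h0.le, one_pow]
        rcases hend i with h | h
        · exact ⟨_, left_mem_Icc.2 (hab i).le, hsq _ h⟩
        · exact ⟨_, right_mem_Icc.2 (hab i).le, hsq _ h⟩) (by
        rw [intervalIntegral.integral_of_le (hab i).le, integral_Ioc_eq_integral_Ioo, hf0]
        refine (hsmall i).le.trans (le_of_eq ?_)
        ring)
    refine hch.trans ?_
    have hj : ∀ j ∈ Finset.range (k / 2),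
        ε ^ (2 * (j+1)) * (∫ t in (aa i)..(bb i), (f j t) ^ 2) ≤ Cc j * ((K + 1) * P * E i) := by
      intro j hj
      rw [Finset.mem_range] at hj
      have hc := hcomb j (by omega) f (aa i) (bb i) δ K (hab i) hδ hK.le hd hcn hpoi
      rw [hδe, hf0, hfn] at hc
      have nn : 0 ≤ ∫ t in (aa i)..(bb i), (f j t) ^ 2 :=
        intervalIntegral.integral_nonneg (hab i).le (fun t _ => sq_nonneg _)
      calc _ ≤ (P * δ ^ (2 * j)) * (∫ t in (aa i)..(bb i), (f j t) ^ 2) :=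
            mul_le_mul_of_nonneg_right (hδj j (by omega)) nn
        _ = P * (δ ^ (2 * j) * (∫ t in (aa i)..(bb i), (f j t) ^ 2)) := by ring
        _ ≤ P * (Cc j * (K + 1) * E i) := mul_le_mul_of_nonneg_left hc hP0.le
        _ = _ := by ring
    calc _ ≤ (N:ℝ) ^ 2 * ∑ j ∈ Finset.range (k / 2), Cc j * ((K + 1) * P * E i) :=
          mul_le_mul_of_nonneg_left (Finset.sum_le_sum hj) (by positivity)
      _ = _ := by rw [← Finset.sum_mul]; ring
  calc ∑ i, (bb i - aa i) ≤ ∑ i, ((∑ j ∈ Finset.range (k / 2), Cc j) * (K + 1) * (N:ℝ) ^ 2 * P) * E i :=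
        Finset.sum_le_sum (fun i _ => key i)
    _ = ((∑ j ∈ Finset.range (k / 2), Cc j) * (K + 1) * (N:ℝ) ^ 2 * P) * ∑ i, E i := by
        rw [Finset.mul_sum]
    _ ≤ ((∑ j ∈ Finset.range (k / 2), Cc j) * (K + 1) * (N:ℝ) ^ 2 * P) * S :=
        mul_le_mul_of_nonneg_left hes (by positivity)
    _ = _ := by ring
end

section
/- Let k ≥ 3 be an integer, S > 0 and θ ∈ (0,1). There exists an integer N₀ ≥ 1, depending only on k, S and θ, such that for every integer N ≥ N₀, every ε ∈ (0, 1/N²), every interval (τ,σ) with 0 < σ−τ ≤ 4Sε, and every function u that is k times continuously differentiable on a neighbourhood of [τ,σ] with F_ε(u; (τ,σ)) ≤ S, |u'(τ)| ≤ 1/√ε, |u'(σ)| ≤ 1/√ε, |u^{(ℓ)}(τ)| ≤ 1/(N ε^ℓ) and |u^{(ℓ)}(σ)| ≤ 1/(N ε^ℓ) for all ℓ ∈ {2,…,k−1}, and |u(σ) − u(τ)| ≥ θ, one has σ − τ ≥ ε/(2N²S). -/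
open MeasureTheory Set

lemma lb_core (m : ℕ) (v : ℕ → ℝ → ℝ) (S ε τ σ : ℝ) (hε : 0 < ε)
    (hτσ : τ < σ) (hL : σ - τ ≤ ε)
    (hd : ∀ j ≤ m, ∀ t ∈ Icc τ σ, HasDerivAt (v j) (v (j+1) t) t)
    (hc : ContinuousOn (v (m+1)) (Icc τ σ))
    (hE : ε ^ (2*m+1) * ∫ t in τ..σ, (v (m+1) t)^2 ≤ S)
    (h0 : ∀ l, 1 ≤ l → l ≤ m → ε^l * |v l τ| ≤ 1) :
    ∀ j, j + 1 ≤ m → ∀ t ∈ Icc τ σ, ε^(m-j) * |v (m-j) t| ≤ 1 + (S+1)/2 + j := by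
  have hτm : τ ∈ Icc τ σ := ⟨le_rfl, hτσ.le⟩
  intro j
  induction j with
  | zero =>
    intro hj t ht
    have hcu : ContinuousOn (v (m+1)) (uIcc τ σ) := by rwa [uIcc_of_le hτσ.le]
    have hi : IntervalIntegrable (v (m+1)) volume τ σ := hcu.intervalIntegrable
    have hsub : uIcc τ t ⊆ uIcc τ σ := by
      rw [uIcc_of_le hτσ.le, uIcc_of_le ht.1]; exact Icc_subset_Icc le_rfl ht.2
    have h1 : ∫ y in τ..t, v (m+1) y = v m t - v m τ := by
      apply intervalIntegral.integral_eq_sub_of_hasDerivAt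
      · intro x hx
        have := hsub hx
        rw [uIcc_of_le hτσ.le] at this
        exact hd m le_rfl x this
      · exact hi.mono_set hsub
    have h2 : |∫ y in τ..t, v (m+1) y| ≤ ∫ y in τ..t, |v (m+1) y| :=
      intervalIntegral.abs_integral_le_integral_abs ht.1
    have h3 : ∫ y in τ..t, |v (m+1) y| ≤ ∫ y in τ..σ, |v (m+1) y| :=
      intervalIntegral.integral_mono_interval le_rfl ht.1 ht.2
        (Filter.Eventually.of_forall fun x => abs_nonneg _) hi.abs
    have h4 : ∫ y in τ..σ, 2 * ε^m * |v (m+1) y| ≤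
        ∫ y in τ..σ, (ε^(2*m+1) * (v (m+1) y)^2 + 1/ε) := by
      apply intervalIntegral.integral_mono_on hτσ.le
      · exact hi.abs.const_mul _
      · exact ((continuousOn_const.mul (hcu.pow 2)).add continuousOn_const).intervalIntegrable
      · intro x _
        have e : ε^(2*m+1) * (v (m+1) x)^2 + 1/ε - 2 * ε^m * |v (m+1) x|
            = (ε^m * |v (m+1) x| * ε - 1)^2 / ε := by
          rw [← sq_abs (v (m+1) x)]
          field_simp
          ring
        have : 0 ≤ (ε^m * |v (m+1) x| * ε - 1)^2 / ε := by positivity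
        linarith
    have hi2 : IntervalIntegrable (fun y => ε^(2*m+1) * (v (m+1) y)^2) volume τ σ :=
      (continuousOn_const.mul (hcu.pow 2)).intervalIntegrable
    rw [intervalIntegral.integral_const_mul, intervalIntegral.integral_add
      hi2 intervalIntegrable_const,
      intervalIntegral.integral_const_mul, intervalIntegral.integral_const, smul_eq_mul] at h4
    have h5 : (σ - τ) * (1/ε) ≤ 1 := by
      rw [mul_one_div, div_le_one hε]; exact hL
    have h6 : |v m t| ≤ |v m τ| + ∫ y in τ..σ, |v (m+1) y| := by
      have : v m t = v m τ + (v m t - v m τ) := by ring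
      rw [this]
      refine (abs_add_le _ _).trans ?_
      rw [← h1]; linarith
    have h7 := mul_le_mul_of_nonneg_left h6 (pow_pos hε m).le
    have h8 := h0 m (by omega) le_rfl
    simp only [Nat.sub_zero, Nat.cast_zero]
    nlinarith
  | succ j ih =>
    intro hj t ht
    obtain ⟨l, hl⟩ : ∃ l, m - (j+1) = l := ⟨_, rfl⟩
    have hl' : m - j = l + 1 := by omega
    have ih := ih (by omega)
    rw [hl'] at ih
    rw [hl]
    have hb : ∀ x ∈ Icc τ σ, ‖v (l+1) x‖ ≤ (1 + (S+1)/2 + j) / ε^(l+1) := by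
      intro x hx
      rw [le_div_iff₀ (by positivity), mul_comm]
      exact ih x hx
    have h1 := (convex_Icc τ σ).norm_image_sub_le_of_norm_hasDerivWithin_le
      (fun x hx => (hd l (by omega) x hx).hasDerivWithinAt) hb hτm ht
    have hC : 0 ≤ 1 + (S+1)/2 + j := le_trans (by positivity) (ih τ hτm)
    have h2 : ‖t - τ‖ ≤ ε := by
      rw [Real.norm_eq_abs, abs_of_nonneg (by linarith [ht.1])]; linarith [ht.2]
    have h3 : ‖v l t - v l τ‖ ≤ (1 + (S+1)/2 + j) / ε^l := by
      refine h1.trans ((mul_le_mul_of_nonneg_left h2 (by positivity)).trans_eq ?_)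
      field_simp
      ring
    rw [le_div_iff₀ (by positivity), Real.norm_eq_abs] at h3
    have h8 := h0 l (by omega) (by omega)
    have h6 : |v l t| ≤ |v l τ| + |v l t - v l τ| := by
      have : v l t = v l τ + (v l t - v l τ) := by ring
      rw [this]
      refine (abs_add_le _ _).trans ?_
      simp
    have h7 := mul_le_mul_of_nonneg_left h6 (pow_pos hε l).le
    push_cast
    nlinarith

/-- Lemma 5.1 of the paper: for jumps of size at least `θ`, the length of the
transition interval `(τ,σ)` (with small derivatives of order `1,…,k-1` at the endpoints and
`σ - τ ≤ 4Sε`) is at least `ε/(2N²S)`, provided `N` is large enough depending on `k`, `S`, `θ`. -/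
theorem length_lower_bound_large_jump (k : ℕ) (hk : 3 ≤ k) (S : ℝ) (hS : 0 < S)
    (θ : ℝ) (hθ : θ ∈ Ioo (0:ℝ) 1) :
    ∃ N₀ : ℕ, 1 ≤ N₀ ∧
      ∀ N : ℕ, N₀ ≤ N →
      ∀ ε : ℝ, ε ∈ Ioo (0:ℝ) (1 / (N:ℝ) ^ 2) →
      ∀ τ σ : ℝ, τ < σ → σ - τ ≤ 4 * S * ε →
      ∀ u : ℝ → ℝ, (∃ U : Set ℝ, IsOpen U ∧ Icc τ σ ⊆ U ∧ ContDiffOn ℝ k u U) →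
      Fe k ε u τ σ ≤ S →
      |deriv u τ| ≤ 1 / Real.sqrt ε → |deriv u σ| ≤ 1 / Real.sqrt ε →
      (∀ ℓ : ℕ, 2 ≤ ℓ → ℓ ≤ k - 1 →
        |iteratedDeriv ℓ u τ| ≤ 1 / ((N:ℝ) * ε ^ ℓ) ∧
        |iteratedDeriv ℓ u σ| ≤ 1 / ((N:ℝ) * ε ^ ℓ)) →
      θ ≤ |u σ - u τ| →
      ε / (2 * (N:ℝ) ^ 2 * S) ≤ σ - τ := by
  obtain ⟨m, rfl⟩ : ∃ m, k = m + 1 := ⟨k - 1, by omega⟩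
  obtain ⟨hθ0, hθ1⟩ := hθ
  set C : ℝ := 1 + (S+1)/2 + m with hCdef
  have hC : 1 ≤ C := by have : (0:ℝ) ≤ m := by positivity
                        linarith
  obtain ⟨n, hn⟩ := exists_nat_gt (C / (2 * S * θ))
  refine ⟨n + 1, by omega, ?_⟩
  intro N hN ε hε τ σ hτσ _ u hu hF hτ _ hder hjump
  obtain ⟨hε0, hεN⟩ := hε
  obtain ⟨U, hUo, hIU, hcd⟩ := hu
  have hN1 : (1:ℝ) ≤ N := by exact_mod_cast (by omega : 1 ≤ N)
  have hnN : (n:ℝ) ≤ N := by exact_mod_cast (by omega : n ≤ N)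
  by_contra hcon
  push Not at hcon
  have hCN : C < N * (2 * S * θ) := by
    have := hn.trans_le hnN
    rwa [div_lt_iff₀ (by positivity)] at this
  have hCL : C * (σ - τ) < θ * ε := by
    rw [lt_div_iff₀ (by positivity)] at hcon
    have hN2 : (N:ℝ) ≤ N^2 := by nlinarith
    have hL0 : 0 < σ - τ := by linarith
    calc C * (σ - τ) ≤ (N * (2 * S * θ)) * (σ - τ) := by gcongr
      _ ≤ (N^2 * (2 * S * θ)) * (σ - τ) := by gcongr
      _ = θ * ((σ - τ) * (2 * N^2 * S)) := by ring
      _ < θ * ε := by gcongr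
  have hL : σ - τ ≤ ε := by nlinarith
  have hε1 : ε ≤ 1 := by
    refine hεN.le.trans ?_
    rw [div_le_one (by positivity)]; nlinarith
  have hd : ∀ j ≤ m, ∀ t ∈ Icc τ σ,
      HasDerivAt (iteratedDeriv j u) (iteratedDeriv (j+1) u t) t := by
    intro j hj t ht
    have h1 : DifferentiableOn ℝ (iteratedDeriv j u) U :=
      (hcd.differentiableOn_iteratedDerivWithin (m := j)
        (by exact_mod_cast Nat.lt_succ_of_le hj) hUo.uniqueDiffOn).congr
        (fun x hx => (iteratedDerivWithin_of_isOpen hUo hx).symm)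
    rw [iteratedDeriv_succ]
    exact (h1.differentiableAt (hUo.mem_nhds (hIU ht))).hasDerivAt
  have hc : ContinuousOn (iteratedDeriv (m+1) u) (Icc τ σ) :=
    ((hcd.continuousOn_iteratedDerivWithin (m := m+1) le_rfl hUo.uniqueDiffOn).congr
      (fun x hx => (iteratedDerivWithin_of_isOpen hUo hx).symm)).mono hIU
  have hE : ε ^ (2*m+1) * ∫ t in τ..σ, (iteratedDeriv (m+1) u t)^2 ≤ S := by
    rw [intervalIntegral.integral_of_le hτσ.le, integral_Ioc_eq_integral_Ioo]
    have h0 : 0 ≤ ∫ t in Ioo τ σ, min ((deriv u t) ^ 2) (1 / ε) :=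
      integral_nonneg fun x => le_min (sq_nonneg _) (by positivity)
    unfold Fe at hF
    have : 2 * (m+1) - 1 = 2*m+1 := by omega
    rw [this] at hF
    linarith
  have h0 : ∀ l, 1 ≤ l → l ≤ m → ε^l * |iteratedDeriv l u τ| ≤ 1 := by
    intro l hl hlm
    rcases Nat.eq_or_lt_of_le hl with h | h
    · subst h
      rw [iteratedDeriv_one, pow_one]
      have hs : 0 < Real.sqrt ε := Real.sqrt_pos.2 hε0
      rw [le_div_iff₀ hs] at hτ
      have hs1 : Real.sqrt ε ≤ 1 := Real.sqrt_le_one.2 hε1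
      have hss : Real.sqrt ε * Real.sqrt ε = ε := Real.mul_self_sqrt hε0.le
      calc ε * |deriv u τ| = Real.sqrt ε * (|deriv u τ| * Real.sqrt ε) := by
            nth_rewrite 1 [← hss]; ring
        _ ≤ 1 * 1 := by gcongr
        _ = 1 := by norm_num
    · have := (hder l h (by omega)).1
      rw [le_div_iff₀ (by positivity)] at this
      have h2 : 0 ≤ ε^l * |iteratedDeriv l u τ| := by positivity
      nlinarith
  have key := lb_core m (fun j => iteratedDeriv j u) S ε τ σ hε0 hτσ hL hd hc hE h0
    (m-1) (by omega)
  have hm1 : m - (m-1) = 1 := by omega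
  have hmc : ((m-1 : ℕ):ℝ) ≤ m := by exact_mod_cast Nat.sub_le m 1
  simp only [hm1, pow_one] at key
  have hb : ∀ x ∈ Icc τ σ, ‖iteratedDeriv 1 u x‖ ≤ C / ε := by
    intro x hx
    rw [le_div_iff₀ hε0, mul_comm]
    refine (key x hx).trans ?_
    rw [hCdef]; linarith
  have h1 := (convex_Icc τ σ).norm_image_sub_le_of_norm_hasDerivWithin_le
      (fun x hx => (hd 0 (by omega) x hx).hasDerivWithinAt) hb
      (left_mem_Icc.2 hτσ.le) (right_mem_Icc.2 hτσ.le)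
  rw [iteratedDeriv_zero, Real.norm_eq_abs, Real.norm_eq_abs, abs_of_pos (sub_pos.2 hτσ),
    div_mul_eq_mul_div, le_div_iff₀ hε0] at h1
  nlinarith
end

section
/- Let k ≥ 3 be an integer, θ ∈ (0,1], N ≥ 1 and ε ∈ (0, 1/N²]. Let τ < σ and let v be k times continuously differentiable on a neighbourhood of [τ,σ] with |v'(τ)| ≤ 1/√ε, |v'(σ)| ≤ 1/√ε and |v^{(ℓ)}(τ)| ≤ 1/(N ε^ℓ), |v^{(ℓ)}(σ)| ≤ 1/(N ε^ℓ) for all ℓ ∈ {2,…,k−1}. If z := v(σ) − v(τ) satisfies |z| ≥ θ, then (σ−τ)/ε + ε^{2k−1} ∫_τ^σ (v^{(k)}(t))² dt ≥ m_k(Nθ) · |z|^{1/k}. -/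
open MeasureTheory Set

/-- The set of admissible energies for the approximate surface energy density `m_k^n(M)`:
values `T + ∫_{-T/2}^{T/2} (v^{(k)})²` over `T > 0` and `v` which are `k` times continuously
differentiable on `[-T/2, T/2]` with `v(∓T/2) = ∓1/2` and `|v^{(ℓ)}(±T/2)| ≤ 1/M` for
`ℓ ∈ {1,…,n}`.  `m_k(M) := m_k^{k-1}(M)` is the infimum of this set with `n = k-1`. -/
def transSet (k n : ℕ) (M : ℝ) : Set ℝ :=
  {E : ℝ | ∃ T : ℝ, 0 < T ∧ ∃ v : ℝ → ℝ,
    ContDiffOn ℝ k v (Icc (-(T/2)) (T/2)) ∧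
    v (-(T/2)) = -(1/2) ∧ v (T/2) = 1/2 ∧
    (∀ ℓ : ℕ, 1 ≤ ℓ → ℓ ≤ n →
      |iteratedDerivWithin ℓ v (Icc (-(T/2)) (T/2)) (-(T/2))| ≤ 1 / M ∧
      |iteratedDerivWithin ℓ v (Icc (-(T/2)) (T/2)) (T/2)| ≤ 1 / M) ∧
    E = T + ∫ t in Icc (-(T/2)) (T/2),
      (iteratedDerivWithin k v (Icc (-(T/2)) (T/2)) t) ^ 2}

lemma iter_affine (f : ℝ → ℝ) (A B L c : ℝ) (n : ℕ) :
    iteratedDeriv (n+1) (fun s => A * (f (L * s + c) - B)) =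
      fun s => A * L ^ (n+1) * iteratedDeriv (n+1) f (L * s + c) := by
  have key : ∀ (g : ℝ → ℝ) (D : ℝ), deriv (fun s => D * g (L * s + c)) =
      fun s => D * L * deriv g (L * s + c) := by
    intro g D
    funext s
    rw [deriv_const_mul_field]
    have h := deriv_comp_mul_left L (fun x => g (x + c)) s
    rw [deriv_comp_add_const] at h
    simp only [smul_eq_mul] at h
    rw [h]; ring
  induction n with
  | zero =>
    rw [zero_add, iteratedDeriv_one, iteratedDeriv_one]
    refine (key (fun x => f x - B) A).trans ?_
    funext s
    rw [deriv_sub_const_fun]; ring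
  | succ n ih =>
    rw [iteratedDeriv_succ, ih, key]
    funext s
    rw [iteratedDeriv_succ (n := n+1)]; ring

/-- the scaling lower estimate (5.10) of the paper: for a transition with
jump `z = v(σ) - v(τ)` of size at least `θ`, with `|v'| ≤ 1/√ε` and `|v^{(ℓ)}| ≤ 1/(Nε^ℓ)`
for `ℓ ∈ {2,…,k-1}` at the endpoints,
`(σ-τ)/ε + ε^{2k-1} ∫_τ^σ (v^{(k)})² ≥ m_k(Nθ) |z|^{1/k}`. -/
theorem scaling_lower_estimate_large_jump (k : ℕ) (hk : 3 ≤ k)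
    (θ : ℝ) (hθ : θ ∈ Ioc (0:ℝ) 1) (N : ℝ) (hN : 1 ≤ N)
    (ε : ℝ) (hε : ε ∈ Ioc (0:ℝ) (1 / N ^ 2))
    (τ σ : ℝ) (hτσ : τ < σ)
    (v : ℝ → ℝ) (hv : ∃ U : Set ℝ, IsOpen U ∧ Icc τ σ ⊆ U ∧ ContDiffOn ℝ k v U)
    (hd1 : |deriv v τ| ≤ 1 / Real.sqrt ε) (hd1' : |deriv v σ| ≤ 1 / Real.sqrt ε)
    (hdℓ : ∀ ℓ : ℕ, 2 ≤ ℓ → ℓ ≤ k - 1 →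
      |iteratedDeriv ℓ v τ| ≤ 1 / (N * ε ^ ℓ) ∧ |iteratedDeriv ℓ v σ| ≤ 1 / (N * ε ^ ℓ))
    (hz : θ ≤ |v σ - v τ|) :
    sInf (transSet k (k - 1) (N * θ)) * |v σ - v τ| ^ ((1:ℝ) / k) ≤
      (σ - τ) / ε + ε ^ (2 * k - 1) * ∫ t in Ioo τ σ, (iteratedDeriv k v t) ^ 2 := by
  obtain ⟨U, hU, hsub, hvU⟩ := hv
  obtain ⟨hθ0, hθ1⟩ := hθ
  obtain ⟨hε0, hε1⟩ := hε
  set z := v σ - v τ with hzdef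
  have hZ : 0 < |z| := lt_of_lt_of_le hθ0 hz
  have hz0 : z ≠ 0 := abs_pos.mp hZ
  have hN0 : 0 < N := by linarith
  set r := |z| ^ ((1:ℝ) / k) with hr
  have hr0 : 0 < r := Real.rpow_pos_of_pos hZ _
  have hrk : r ^ k = |z| := by
    rw [hr, one_div, Real.rpow_inv_natCast_pow hZ.le (by omega)]
  set L := ε * r with hL
  have hL0 : 0 < L := mul_pos hε0 hr0
  set c := (τ + σ) / 2 with hc
  set T := (σ - τ) / L with hT
  have hT0 : 0 < T := div_pos (by linarith) hL0
  have hLT : L * T = σ - τ := by rw [hT]; field_simp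
  have e1 : L * (-(T/2)) + c = τ := by linarith
  have e2 : L * (T/2) + c = σ := by linarith
  set w : ℝ → ℝ := fun s => z⁻¹ * (v (L * s + c) - (v τ + v σ) / 2) with hw
  have hmaps : ∀ s ∈ Icc (-(T/2)) (T/2), L * s + c ∈ U := by
    intro s hs
    apply hsub
    constructor
    · rw [← e1]; have := mul_le_mul_of_nonneg_left hs.1 hL0.le; linarith
    · rw [← e2]; have := mul_le_mul_of_nonneg_left hs.2 hL0.le; linarith
  have hcd : ∀ s ∈ Icc (-(T/2)) (T/2), ContDiffAt ℝ k w s := by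
    intro s hs
    have h1 : ContDiffAt ℝ k v (L * s + c) := hvU.contDiffAt (hU.mem_nhds (hmaps s hs))
    have h2 : ContDiffAt ℝ k (fun s : ℝ => L * s + c) s := by fun_prop
    have h3 : ContDiffAt ℝ k (fun s => v (L * s + c)) s := ContDiffAt.comp s h1 h2
    exact contDiffAt_const.mul (h3.sub contDiffAt_const)
  have hI : UniqueDiffOn ℝ (Icc (-(T/2)) (T/2)) := uniqueDiffOn_Icc (by linarith)
  have hiter : ∀ ℓ : ℕ, 1 ≤ ℓ → ℓ ≤ k → ∀ s ∈ Icc (-(T/2)) (T/2),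
      iteratedDerivWithin ℓ w (Icc (-(T/2)) (T/2)) s =
        z⁻¹ * L ^ ℓ * iteratedDeriv ℓ v (L * s + c) := by
    intro ℓ h1 h2 s hs
    rw [iteratedDerivWithin_eq_iteratedDeriv hI
      ((hcd s hs).of_le (by exact_mod_cast h2)) hs]
    obtain ⟨n, rfl⟩ : ∃ n, ℓ = n + 1 := ⟨ℓ - 1, by omega⟩
    rw [hw, iter_affine]
  have hθr : ∀ ℓ : ℕ, ℓ ≤ k → r ^ ℓ * θ ≤ |z| := by
    intro ℓ hℓ
    have : θ ≤ r ^ (k - ℓ) := by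
      rcases le_total 1 r with h | h
      · exact hθ1.trans (one_le_pow₀ h)
      · calc θ ≤ r ^ k := by rw [hrk]; exact hz
          _ ≤ _ := pow_le_pow_of_le_one hr0.le h (by omega)
    calc r ^ ℓ * θ ≤ r ^ ℓ * r ^ (k - ℓ) := by gcongr
      _ = |z| := by rw [← pow_add, ← hrk]; congr 1; omega
  have hsq : Real.sqrt ε ≤ 1 / N := by
    rw [Real.sqrt_le_left (by positivity)]
    rw [div_pow, one_pow]; exact hε1
  have hs0 : 0 < Real.sqrt ε := Real.sqrt_pos.mpr hε0
  have hconv : 1 / Real.sqrt ε ≤ 1 / (N * ε) := by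
    apply one_div_le_one_div_of_le (by positivity)
    calc N * ε = N * Real.sqrt ε * Real.sqrt ε := by
          rw [mul_assoc, Real.mul_self_sqrt hε0.le]
      _ ≤ 1 * Real.sqrt ε := by
          gcongr
          rw [le_div_iff₀ hN0] at hsq; linarith
      _ = _ := one_mul _
  have hall : ∀ ℓ : ℕ, 1 ≤ ℓ → ℓ ≤ k - 1 →
      |iteratedDeriv ℓ v τ| ≤ 1 / (N * ε ^ ℓ) ∧ |iteratedDeriv ℓ v σ| ≤ 1 / (N * ε ^ ℓ) := by
    intro ℓ h1 h2
    rcases Nat.lt_or_ge 1 ℓ with h | h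
    · exact hdℓ ℓ h h2
    · obtain rfl : ℓ = 1 := le_antisymm h h1
      rw [iteratedDeriv_one, pow_one]
      exact ⟨hd1.trans hconv, hd1'.trans hconv⟩
  have hbd : ∀ ℓ : ℕ, ℓ ≤ k → ∀ x : ℝ, |x| ≤ 1 / (N * ε ^ ℓ) →
      |z⁻¹ * L ^ ℓ * x| ≤ 1 / (N * θ) := by
    intro ℓ hℓ x hx
    rw [abs_mul, abs_mul, abs_inv, abs_of_pos (pow_pos hL0 ℓ)]
    calc |z|⁻¹ * L ^ ℓ * |x| ≤ |z|⁻¹ * L ^ ℓ * (1 / (N * ε ^ ℓ)) := by gcongr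
      _ = r ^ ℓ / (|z| * N) := by rw [hL, mul_pow]; field_simp
      _ ≤ 1 / (N * θ) := by
        rw [div_le_div_iff₀ (by positivity) (by positivity)]
        have := mul_le_mul_of_nonneg_left (hθr ℓ hℓ) hN0.le
        linarith
  have hl : -(T/2) ∈ Icc (-(T/2)) (T/2) := ⟨le_rfl, by linarith⟩
  have hrr : (T/2) ∈ Icc (-(T/2)) (T/2) := ⟨by linarith, le_rfl⟩
  have hmem : T + ∫ t in Icc (-(T/2)) (T/2),
      (iteratedDerivWithin k w (Icc (-(T/2)) (T/2)) t) ^ 2 ∈ transSet k (k-1) (N * θ) := by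
    refine ⟨T, hT0, w, fun s hs => (hcd s hs).contDiffWithinAt, ?_, ?_, ?_, rfl⟩
    · simp only [hw, e1]
      rw [inv_mul_eq_div, div_eq_iff hz0, hzdef]; ring
    · simp only [hw, e2]
      rw [inv_mul_eq_div, div_eq_iff hz0, hzdef]; ring
    · intro ℓ h1 h2
      rw [hiter ℓ h1 (by omega) _ hl, hiter ℓ h1 (by omega) _ hrr, e1, e2]
      exact ⟨hbd ℓ (by omega) _ (hall ℓ h1 h2).1, hbd ℓ (by omega) _ (hall ℓ h1 h2).2⟩
  have hbb : BddBelow (transSet k (k-1) (N * θ)) := by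
    refine ⟨0, ?_⟩
    rintro E ⟨S, hS, u, -, -, -, -, rfl⟩
    have : 0 ≤ ∫ t in Icc (-(S/2)) (S/2),
      (iteratedDerivWithin k u (Icc (-(S/2)) (S/2)) t) ^ 2 :=
      integral_nonneg (fun t => sq_nonneg _)
    linarith
  have hle := mul_le_mul_of_nonneg_right (csInf_le hbb hmem) hr0.le
  refine hle.trans (le_of_eq ?_)
  have hint : ∫ t in Icc (-(T/2)) (T/2),
      (iteratedDerivWithin k w (Icc (-(T/2)) (T/2)) t) ^ 2 =
      (z⁻¹ * L ^ k) ^ 2 * (L⁻¹ * ∫ t in Ioo τ σ, (iteratedDeriv k v t) ^ 2) := by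
    rw [setIntegral_congr_fun measurableSet_Icc
      (g := fun t => (z⁻¹ * L ^ k) ^ 2 * (iteratedDeriv k v (L * t + c)) ^ 2)
      (fun t ht => by
        simp only []
        rw [hiter k (by omega) le_rfl t ht]; ring)]
    rw [integral_const_mul, integral_Icc_eq_integral_Ioc,
      ← intervalIntegral.integral_of_le (by linarith : -(T/2) ≤ T/2),
      intervalIntegral.integral_comp_mul_add (fun t => (iteratedDeriv k v t) ^ 2) hL0.ne' c,
      e1, e2, intervalIntegral.integral_of_le hτσ.le, integral_Ioc_eq_integral_Ioo, smul_eq_mul]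
  rw [hint]
  generalize (∫ t in Ioo τ σ, (iteratedDeriv k v t) ^ 2) = J
  have hz2 : z ^ 2 = (r ^ k) ^ 2 := by rw [hrk, sq_abs]
  have h5 : (z⁻¹ * L ^ k) ^ 2 = (ε ^ k) ^ 2 := by
    rw [mul_pow, inv_pow, hz2, hL, mul_pow, mul_pow]; field_simp
  have h6 : (ε ^ k) ^ 2 = ε ^ (2 * k - 1) * ε := by
    rw [← pow_mul, ← pow_succ]; congr 1; omega
  rw [h5, h6, hT, hL]
  field_simp
end

section
/- Let k ≥ 2 be an integer. For c > 0 let m_k^{1,c} denote the infimum, over all T > 0 and all k times continuously differentiable functions v : [−T/2, T/2] → ℝ with v(−T/2) = −1/2, v(T/2) = 1/2 and v^{(ℓ)}(±T/2) = 0 for all ℓ ∈ {1,…,k−1}, of T + c ∫_{−T/2}^{T/2} (v^{(k)}(t))² dt. Then for every μ > 0 there exists c > 0 such that m_k^{1,c} = μ. -/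
open MeasureTheory Set

/-- The admissible energies defining `m_k^{1,c}`: values `T + c ∫_{-T/2}^{T/2} (v^{(k)})²`
over `T > 0` and `k` times continuously differentiable `v : [-T/2, T/2] → ℝ` with
`v(∓T/2) = ∓1/2` and `v^{(ℓ)}(±T/2) = 0` for `ℓ ∈ {1,…,k-1}`; `m_k^{1,c}` is its infimum. -/
def mkcSet (k : ℕ) (c : ℝ) : Set ℝ :=
  {E : ℝ | ∃ T : ℝ, 0 < T ∧ ∃ v : ℝ → ℝ,
    ContDiffOn ℝ k v (Icc (-(T/2)) (T/2)) ∧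
    v (-(T/2)) = -(1/2) ∧ v (T/2) = 1/2 ∧
    (∀ ℓ : ℕ, 1 ≤ ℓ → ℓ ≤ k - 1 →
      iteratedDerivWithin ℓ v (Icc (-(T/2)) (T/2)) (-(T/2)) = 0 ∧
      iteratedDerivWithin ℓ v (Icc (-(T/2)) (T/2)) (T/2) = 0) ∧
    E = T + c * ∫ t in Icc (-(T/2)) (T/2),
      (iteratedDerivWithin k v (Icc (-(T/2)) (T/2)) t) ^ 2}

lemma mk_hasDeriv {k : ℕ} {v : ℝ → ℝ} {a b : ℝ} (hab : a < b)
    (hv : ContDiffOn ℝ k v (Icc a b)) {n : ℕ} (hn : n < k) {x : ℝ} (hx : x ∈ Icc a b) :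
    HasDerivWithinAt (iteratedDerivWithin n v (Icc a b))
      (iteratedDerivWithin (n+1) v (Icc a b) x) (Icc a b) x := by
  rw [iteratedDerivWithin_succ]
  exact ((hv.differentiableOn_iteratedDerivWithin (by exact_mod_cast hn)
    (uniqueDiffOn_Icc hab)) x hx).hasDerivWithinAt

lemma mk_scale_deriv {k : ℕ} {v : ℝ → ℝ} {T L : ℝ} (hT : 0 < T) (hL : 0 < L)
    (hv : ContDiffOn ℝ k v (Icc (-(T/2)) (T/2)))
    (hm : MapsTo (fun x => x / L) (Icc (-(L*T/2)) (L*T/2)) (Icc (-(T/2)) (T/2))) (n : ℕ) :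
    n ≤ k → ∀ x ∈ Icc (-(L*T/2)) (L*T/2),
    iteratedDerivWithin n (fun x => v (x / L)) (Icc (-(L*T/2)) (L*T/2)) x
      = (L⁻¹)^n * iteratedDerivWithin n v (Icc (-(T/2)) (T/2)) (x / L) := by
  have hLT : 0 < L * T := mul_pos hL hT
  induction n with
  | zero => intro _ x hx; simp
  | succ n ih =>
    intro hn x hx
    have ih := ih (by omega)
    rw [iteratedDerivWithin_succ, derivWithin_congr (fun y hy => ih y hy) (ih x hx)]
    have h1 := mk_hasDeriv (by linarith) hv (n := n) (by omega) (hm hx)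
    have h2 : HasDerivWithinAt (fun x : ℝ => x / L) (1 / L) (Icc (-(L*T/2)) (L*T/2)) x :=
      (hasDerivWithinAt_id x _).div_const L
    have h3 := (h1.comp x h2 hm).const_mul ((L⁻¹)^n)
    have h4 := h3.derivWithin (uniqueDiffOn_Icc (by linarith) x hx)
    simp only [Function.comp_def] at h4
    rw [h4]
    ring

lemma mk_scale {k : ℕ} {c L E : ℝ} (hL : 0 < L) (hE : E ∈ mkcSet k c) :
    L * E ∈ mkcSet k (c * L^(2*k)) := by
  obtain ⟨T, hT, v, hv, h0, h1, hb, rfl⟩ := hE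
  have hLT : 0 < L * T := mul_pos hL hT
  have hm : MapsTo (fun x => x / L) (Icc (-(L*T/2)) (L*T/2)) (Icc (-(T/2)) (T/2)) := by
    intro x hx
    constructor
    · rw [le_div_iff₀ hL]; linarith [hx.1]
    · rw [div_le_iff₀ hL]; linarith [hx.2]
  have key := mk_scale_deriv hT hL hv hm
  have el : -(L*T/2)/L = -(T/2) := by field_simp
  have er : (L*T/2)/L = T/2 := by field_simp
  have ml : -(L*T/2) ∈ Icc (-(L*T/2)) (L*T/2) := ⟨le_rfl, by linarith⟩
  have mr : (L*T/2) ∈ Icc (-(L*T/2)) (L*T/2) := ⟨by linarith, le_rfl⟩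
  refine ⟨L*T, hLT, fun x => v (x / L), hv.comp (contDiff_id.div_const L).contDiffOn hm,
    by simp only [el, h0], by simp only [er, h1], ?_, ?_⟩
  · intro l hl hl'
    rw [key l (by omega) _ ml, key l (by omega) _ mr, el, er, (hb l hl hl').1, (hb l hl hl').2]
    simp
  · rw [setIntegral_congr_fun (s := Icc (-(L*T/2)) (L*T/2)) (g := fun t => ((L⁻¹)^k * iteratedDerivWithin k v
      (Icc (-(T/2)) (T/2)) (t / L))^2) measurableSet_Icc
      (fun t ht => by simp only [key k le_rfl t ht])]
    rw [integral_Icc_eq_integral_Ioc, integral_Icc_eq_integral_Ioc,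
      ← intervalIntegral.integral_of_le (by linarith),
      ← intervalIntegral.integral_of_le (by linarith)]
    rw [intervalIntegral.integral_comp_div (fun t => ((L⁻¹)^k * iteratedDerivWithin k v
      (Icc (-(T/2)) (T/2)) t)^2) hL.ne', el, er]
    simp only [mul_pow, intervalIntegral.integral_const_mul, smul_eq_mul]
    have : L^(2*k) * ((L⁻¹)^k)^2 = 1 := by
      rw [inv_pow, inv_pow, ← pow_mul, mul_comm k 2]
      exact mul_inv_cancel₀ (by positivity)
    linear_combination (-c * L * ∫ t in (-(T/2))..(T/2),
      (iteratedDerivWithin k v (Icc (-(T/2)) (T/2)) t)^2) * this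

lemma mk_nonempty (k : ℕ) : (mkcSet k 1).Nonempty := by
  refine ⟨_, 3, by norm_num, fun x => Real.smoothTransition (x + 1/2) - 1/2, ?_, ?_, ?_, ?_, rfl⟩
  · exact ((Real.smoothTransition.contDiff (n := k)).comp
      (contDiff_id.add contDiff_const)).sub contDiff_const |>.contDiffOn
  · beta_reduce
    rw [Real.smoothTransition.zero_of_nonpos (by norm_num)]; norm_num
  · beta_reduce
    rw [Real.smoothTransition.one_of_one_le (by norm_num)]; norm_num
  · intro l hl _
    constructor
    · rw [Filter.EventuallyEq.iteratedDerivWithin_eq (g := fun _ => -(1/2:ℝ)),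
        iteratedDerivWithin_const, if_neg (by omega)]
      · apply Filter.Eventually.filter_mono nhdsWithin_le_nhds
        filter_upwards [Iio_mem_nhds (show -((3:ℝ)/2) < -1 by norm_num)] with x hx
        rw [Real.smoothTransition.zero_of_nonpos (by linarith [mem_Iio.1 hx])]; norm_num
      · rw [Real.smoothTransition.zero_of_nonpos (by norm_num)]; norm_num
    · rw [Filter.EventuallyEq.iteratedDerivWithin_eq (g := fun _ => (1/2:ℝ)),
        iteratedDerivWithin_const, if_neg (by omega)]
      · apply Filter.Eventually.filter_mono nhdsWithin_le_nhds
        filter_upwards [Ioi_mem_nhds (show (1:ℝ) < (3:ℝ)/2 by norm_num)] with x hx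
        rw [Real.smoothTransition.one_of_one_le (by linarith [mem_Ioi.1 hx])]; norm_num
      · rw [Real.smoothTransition.one_of_one_le (by norm_num)]; norm_num

lemma mk_lower {k : ℕ} (hk : 2 ≤ k) {E : ℝ} (hE : E ∈ mkcSet k 1) : 1 ≤ E := by
  obtain ⟨T, hT, v, hv, h0, h1, hb, rfl⟩ := hE
  have hab : -(T/2) < T/2 := by linarith
  set s := Icc (-(T/2)) (T/2) with hs
  have hI : 0 ≤ ∫ t in s, (iteratedDerivWithin k v s t)^2 :=
    integral_nonneg fun t => sq_nonneg _
  rcases le_or_gt 1 T with h | hT1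
  · linarith
  have hcont : ContinuousOn (iteratedDerivWithin k v s) s :=
    hv.continuousOn_iteratedDerivWithin le_rfl (uniqueDiffOn_Icc hab)
  set A := ∫ t in s, |iteratedDerivWithin k v s t| with hA
  have hint : IntegrableOn (fun t => |iteratedDerivWithin k v s t|) s :=
    hcont.abs.integrableOn_Icc
  have hint2 : IntegrableOn (fun t => (iteratedDerivWithin k v s t)^2) s :=
    (hcont.pow 2).integrableOn_Icc
  have hA0 : 0 ≤ A := integral_nonneg fun t => abs_nonneg _
  have hAle : 2 * A ≤ T + ∫ t in s, (iteratedDerivWithin k v s t)^2 := by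
    have hc : IntegrableOn (fun _ : ℝ => (1:ℝ)) s := continuousOn_const.integrableOn_Icc
    have e : T + ∫ t in s, (iteratedDerivWithin k v s t)^2
        = ∫ t in s, (1 + (iteratedDerivWithin k v s t)^2) := by
      rw [integral_add hc hint2]
      simp [hs, hT.le]
    rw [e, hA, ← integral_const_mul]
    apply integral_mono (hint.const_mul 2) (hc.add hint2)
    intro t
    have := sq_nonneg (|iteratedDerivWithin k v s t| - 1)
    have h2 := sq_abs (iteratedDerivWithin k v s t)
    simp only [Pi.add_apply]
    nlinarith
  -- top order bound
  have main : ∀ j, j + 1 ≤ k - 1 → ∀ t ∈ s, |iteratedDerivWithin (k - 1 - j) v s t| ≤ A := by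
    intro j
    induction j with
    | zero =>
      intro hj t ht
      have hsub : Icc (-(T/2)) t ⊆ s := Icc_subset_Icc_right ht.2
      have hk1 : k - 1 + 1 = k := by omega
      have ftc := intervalIntegral.integral_eq_sub_of_hasDerivAt_of_le
        (f := iteratedDerivWithin (k-1) v s) (f' := iteratedDerivWithin k v s) ht.1
        ((hv.continuousOn_iteratedDerivWithin (by exact_mod_cast Nat.sub_le k 1)
          (uniqueDiffOn_Icc hab)).mono hsub)
        (fun x hx => by
          have := mk_hasDeriv hab hv (n := k-1) (by omega) (hsub (Ioo_subset_Icc_self hx))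
          rw [hk1] at this
          exact this.hasDerivAt (Icc_mem_nhds hx.1 (hx.2.trans_le ht.2)))
        ((hcont.mono (by rw [uIcc_of_le ht.1]; exact hsub)).intervalIntegrable)
      rw [(hb (k-1) (by omega) le_rfl).1, sub_zero] at ftc
      rw [Nat.sub_zero, ← ftc]
      refine (intervalIntegral.abs_integral_le_integral_abs ht.1).trans ?_
      rw [intervalIntegral.integral_of_le ht.1]
      exact setIntegral_mono_set hint (ae_of_all _ fun _ => abs_nonneg _)
        (Ioc_subset_Icc_self.trans hsub).eventuallyLE
    | succ j ih =>
      intro hj t ht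
      have ih := ih (by omega)
      have e : k - 1 - (j+1) + 1 = k - 1 - j := by omega
      have := (convex_Icc (-(T/2)) (T/2)).norm_image_sub_le_of_norm_hasDerivWithin_le
        (f := iteratedDerivWithin (k-1-(j+1)) v s) (f' := iteratedDerivWithin (k-1-j) v s) (C := A)
        (fun x hx => by
          have := mk_hasDeriv hab hv (n := k-1-(j+1)) (by omega) hx
          rwa [e] at this) ih (left_mem_Icc.2 hab.le) ht
      rw [(hb (k-1-(j+1)) (by omega) (by omega)).1, sub_zero, Real.norm_eq_abs,
        Real.norm_eq_abs, abs_of_nonneg (a := t - -(T/2)) (by linarith [ht.1])] at this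
      nlinarith [ht.2]
  have hd := main (k-2) (by omega)
  have e1 : k - 1 - (k-2) = 1 := by omega
  rw [e1] at hd
  have := (convex_Icc (-(T/2)) (T/2)).norm_image_sub_le_of_norm_hasDerivWithin_le
        (f := v) (f' := iteratedDerivWithin 1 v s) (C := A)
        (fun x hx => by
          have := mk_hasDeriv hab hv (n := 0) (by omega) hx
          rwa [iteratedDerivWithin_zero] at this) hd (left_mem_Icc.2 hab.le)
          (right_mem_Icc.2 hab.le)
  rw [h0, h1, Real.norm_eq_abs, Real.norm_eq_abs, abs_of_nonneg (a := T/2 - -(T/2)) (by linarith),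
    abs_of_nonneg (by norm_num)] at this
  nlinarith

/-- normalization step of Proposition 6.3 of the paper: for every `μ > 0`
there exists `c > 0` with `m_k^{1,c} = μ`. -/
theorem normalization_of_mk (k : ℕ) (hk : 2 ≤ k) :
    ∀ μ : ℝ, 0 < μ → ∃ c : ℝ, 0 < c ∧ sInf (mkcSet k c) = μ := by
  intro μ hμ
  have hm : 1 ≤ sInf (mkcSet k 1) := le_csInf (mk_nonempty k) fun E hE => mk_lower hk hE
  set m := sInf (mkcSet k 1) with hmdef
  have hm0 : 0 < m := by linarith
  have hL : 0 < μ / m := div_pos hμ hm0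
  set L := μ / m with hLdef
  have hbdd : BddBelow (mkcSet k 1) := ⟨1, fun E hE => mk_lower hk hE⟩
  refine ⟨1 * L^(2*k), by positivity, ?_⟩
  have hLm : L * m = μ := by rw [hLdef]; field_simp
  rw [← hLm]
  apply IsGLB.csInf_eq
  · constructor
    · intro E hE
      have h := mk_scale (inv_pos.2 hL) hE
      have e : 1 * L^(2*k) * L⁻¹^(2*k) = 1 := by
        rw [inv_pow, one_mul]; exact mul_inv_cancel₀ (by positivity)
      rw [e] at h
      have := csInf_le hbdd h
      rw [← hmdef] at this
      calc L * m ≤ L * (L⁻¹ * E) := by gcongr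
        _ = E := by field_simp
    · intro b hb
      have : b / L ≤ m := by
        apply le_csInf (mk_nonempty k)
        intro E hE
        rw [div_le_iff₀ hL, mul_comm]
        exact hb (mk_scale hL hE)
      rw [div_le_iff₀ hL] at this
      linarith
  · obtain ⟨E, hE⟩ := mk_nonempty k
    exact ⟨_, mk_scale hL hE⟩
end

section
/- Let f : [0,∞) → [0,∞) be nondecreasing with f(0) = 0, differentiable at 0 with f'(0) = α > 0, and such that f(z) → β as z → +∞ with β > 0. Let 𝒜 = { a > 0 : there exists b > 0 with min{a z, b} ≤ f(z) for all z ≥ 0 } and ℬ = { b > 0 : there exists a > 0 with min{a z, b} ≤ f(z) for all z ≥ 0 }. Then sup 𝒜 = α and sup ℬ = β. -/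
open Set Filter

/-- envelope computation underlying Proposition 6.2 of the paper: for a
nondecreasing `f : [0,∞) → [0,∞)` with `f(0) = 0`, one-sided derivative `α > 0` at `0` and
limit `β > 0` at `+∞`, the supremum of the slopes `a` (resp. of the plateaux `b`) of the
truncated-linear functions `z ↦ min{az, b}` lying below `f` equals `α` (resp. `β`). -/
theorem truncated_linear_envelope (f : ℝ → ℝ)
    (hf_nonneg : ∀ z : ℝ, 0 ≤ z → 0 ≤ f z)
    (hf_mono : MonotoneOn f (Ici (0:ℝ)))
    (hf0 : f 0 = 0)
    (α : ℝ) (hα : 0 < α) (hf' : HasDerivWithinAt f α (Ici (0:ℝ)) 0)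
    (β : ℝ) (hβ : 0 < β) (hflim : Tendsto f atTop (nhds β)) :
    sSup {a : ℝ | 0 < a ∧ ∃ b : ℝ, 0 < b ∧ ∀ z : ℝ, 0 ≤ z → min (a * z) b ≤ f z} = α ∧
    sSup {b : ℝ | 0 < b ∧ ∃ a : ℝ, 0 < a ∧ ∀ z : ℝ, 0 ≤ z → min (a * z) b ≤ f z} = β := by
  have hslope : Tendsto (fun z => f z / z) (nhdsWithin 0 (Ioi (0:ℝ))) (nhds α) := by
    have h1 : HasDerivWithinAt f α (Ioi (0:ℝ)) 0 := hf'.mono Ioi_subset_Ici_self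
    rw [hasDerivWithinAt_iff_tendsto_slope' (by simp)] at h1
    refine h1.congr' ?_
    filter_upwards with z
    simp [slope_def_field, hf0]
  have key : ∀ a : ℝ, a < α → ∃ δ : ℝ, 0 < δ ∧ ∀ z : ℝ, 0 ≤ z → z ≤ δ → a * z ≤ f z := by
    intro a ha
    have h := hslope.eventually (lt_mem_nhds ha)
    obtain ⟨u, hu, hu2⟩ := (mem_nhdsGT_iff_exists_Ioc_subset).1 h
    refine ⟨u, hu, fun z hz hzu => ?_⟩
    rcases hz.eq_or_lt with h0 | h0
    · subst h0; simp [hf0]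
    · have h3 : a < f z / z := hu2 ⟨h0, hzu⟩
      exact ((lt_div_iff₀ h0).1 h3).le
  constructor
  · apply csSup_eq_of_forall_le_of_forall_lt_exists_gt
    · obtain ⟨δ, hδ, h⟩ := key (α / 2) (by linarith)
      refine ⟨α / 2, by positivity, α / 2 * δ, by positivity, fun z hz => ?_⟩
      rcases le_total z δ with hz2 | hz2
      · exact (min_le_left _ _).trans (h z hz hz2)
      · exact (min_le_right _ _).trans ((h δ hδ.le le_rfl).trans (hf_mono hδ.le hz hz2))
    · rintro a ⟨ha, b, hb, h⟩
      refine ge_of_tendsto hslope ?_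
      have : Ioc 0 (b / a) ∈ nhdsWithin 0 (Ioi (0:ℝ)) := Ioc_mem_nhdsGT (by positivity)
      filter_upwards [this] with z hz
      have h2 := h z hz.1.le
      rw [min_eq_left (by rw [mul_comm]; exact (le_div_iff₀ ha).1 hz.2)] at h2
      exact (le_div_iff₀ hz.1).2 h2
    · intro w hw
      have h1 : max w 0 < α := max_lt hw hα
      obtain ⟨a, ha1, ha2⟩ := exists_between h1
      have ha : 0 < a := (le_max_right _ _).trans_lt ha1
      obtain ⟨δ, hδ, h⟩ := key a ha2
      refine ⟨a, ⟨ha, a * δ, by positivity, fun z hz => ?_⟩, (le_max_left _ _).trans_lt ha1⟩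
      rcases le_total z δ with hz2 | hz2
      · exact (min_le_left _ _).trans (h z hz hz2)
      · exact (min_le_right _ _).trans ((h δ hδ.le le_rfl).trans (hf_mono hδ.le hz hz2))
  · have key2 : ∀ b : ℝ, b < β → ∃ a : ℝ, 0 < a ∧ ∀ z : ℝ, 0 ≤ z → min (a * z) b ≤ f z := by
      intro b hb
      obtain ⟨M, hM⟩ := eventually_atTop.1 (hflim.eventually (lt_mem_nhds hb))
      obtain ⟨δ, hδ, h⟩ := key (α / 2) (by linarith)
      have hN : 0 < max M 1 := lt_max_of_lt_right one_pos
      refine ⟨min (α / 2) (α / 2 * δ / max M 1), by positivity, fun z hz => ?_⟩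
      rcases le_total z δ with hz2 | hz2
      · refine (min_le_left _ _).trans (le_trans ?_ (h z hz hz2))
        exact mul_le_mul_of_nonneg_right (min_le_left _ _) hz
      · rcases le_total z (max M 1) with hz3 | hz3
        · refine (min_le_left _ _).trans
            (le_trans ?_ ((h δ hδ.le le_rfl).trans (hf_mono hδ.le hz hz2)))
          calc _ ≤ α / 2 * δ / max M 1 * max M 1 :=
                mul_le_mul (min_le_right _ _) hz3 hz (by positivity)
            _ = α / 2 * δ := by field_simp
        · exact (min_le_right _ _).trans (hM z ((le_max_left _ _).trans hz3)).le
    apply csSup_eq_of_forall_le_of_forall_lt_exists_gt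
    · exact ⟨β / 2, by positivity, key2 _ (by linarith)⟩
    · rintro b ⟨hb, a, ha, h⟩
      refine ge_of_tendsto hflim ?_
      filter_upwards [eventually_ge_atTop (b / a)] with z hz
      have h2 := h z (le_trans (by positivity) hz)
      rwa [min_eq_right (by rw [mul_comm]; exact (div_le_iff₀ ha).1 hz)] at h2
    · intro w hw
      obtain ⟨b, hb1, hb2⟩ := exists_between (max_lt hw hβ)
      exact ⟨b, ⟨(le_max_right _ _).trans_lt hb1, key2 b hb2⟩, (le_max_left _ _).trans_lt hb1⟩
end
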